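/- Let 0 < p, θ ≤ ∞ and let Ω satisfy conditions (I)–(III) and conditions (a),(b) with exponents μ > 0 and ρ < min(r, r − 1 + 1/p). If a function g on 𝕀^d is represented by a series g = Σ_{k∈ℤ_+^d} g_k with g_k ∈ Σ_r^d(k), converging in the norm of L_∞(𝕀^d), and B_4(g) := ( Σ_{k∈ℤ_+^d} { ‖g_k‖_p / Ω(2^{-k}) }^θ )^{1/θ} < ∞, then g belongs to B^Ω_{p,θ} and ‖g‖_{B^Ω_{p,θ}} ≤ C B_4(g) with C independent of g. -/

import Mathlib

open MeasureTheory Filter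
open scoped ENNReal Classical BigOperators

noncomputable section

namespace SparseGrid

/-- The unit cube `[0,1]^d`. -/
def cube (d : ℕ) : Set (Fin d → ℝ) := Set.univ.pi fun _ => Set.Icc (0:ℝ) 1

/-- The `L_p` quasi-norm on the unit cube. -/
def lpQ (d : ℕ) (p : ℝ≥0∞) (f : (Fin d → ℝ) → ℝ) : ℝ≥0∞ :=
  eLpNorm f p (volume.restrict (cube d))

/-- Univariate `r`-th difference applied in coordinate `i`. -/
def diffC (d r : ℕ) (i : Fin d) (h : ℝ) (f : (Fin d → ℝ) → ℝ) (x : Fin d → ℝ) : ℝ :=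
  ∑ j ∈ Finset.range (r + 1),
    (-1 : ℝ) ^ (r - j) * (r.choose j : ℝ) * f (Function.update x i (x i + j * h))

/-- The mixed `(r,e)`-th difference operator. -/
def mixDiff (d r : ℕ) (e : Finset (Fin d)) (h : Fin d → ℝ) (f : (Fin d → ℝ) → ℝ) :
    (Fin d → ℝ) → ℝ :=
  e.toList.foldr (fun i g => diffC d r i (h i) g) f

/-- The set `𝕀^d(h,e)`. -/
def cubeHE (d r : ℕ) (h : Fin d → ℝ) (e : Finset (Fin d)) : Set (Fin d → ℝ) :=
  {x | x ∈ cube d ∧ ∀ i ∈ e, x i + r * h i ∈ Set.Icc (0:ℝ) 1}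

/-- The mixed `(r,e)`-th modulus of smoothness in `L_p`. -/
def modulus (d r : ℕ) (e : Finset (Fin d)) (p : ℝ≥0∞) (f : (Fin d → ℝ) → ℝ)
    (t : Fin d → ℝ) : ℝ≥0∞ :=
  ⨆ (h : Fin d → ℝ) (_ : ∀ i ∈ e, |h i| < t i),
    eLpNorm (mixDiff d r e h f) p (volume.restrict (cubeHE d r h e))

/-- `t^e`. -/
def tE (d : ℕ) (e : Finset (Fin d)) (t : Fin d → ℝ) : Fin d → ℝ :=
  fun i => if i ∈ e then t i else 1

/-- The Besov-type quasi-seminorm `|f|_{B^Ω_{p,θ}(e)}`. -/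
def besovSemi (d r : ℕ) (p θ : ℝ≥0∞) (Ω : (Fin d → ℝ) → ℝ) (e : Finset (Fin d))
    (f : (Fin d → ℝ) → ℝ) : ℝ≥0∞ :=
  if θ = ∞ then
    ⨆ (t : Fin d → ℝ) (_ : t ∈ cube d),
      modulus d r e p f t / ENNReal.ofReal (Ω (tE d e t))
  else
    (∫⁻ t in cube d,
        (modulus d r e p f t / ENNReal.ofReal (Ω (tE d e t))) ^ θ.toReal *
          ∏ i ∈ e, ENNReal.ofReal (t i)⁻¹) ^ (1 / θ.toReal)

/-- The Besov-type quasi-norm `‖f‖_{B^Ω_{p,θ}}`. -/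
def besovNorm (d r : ℕ) (p θ : ℝ≥0∞) (Ω : (Fin d → ℝ) → ℝ)
    (f : (Fin d → ℝ) → ℝ) : ℝ≥0∞ :=
  ∑ e : Finset (Fin d), besovSemi d r p θ Ω e f

/-- The dyadic vector `2^{-k}`. -/
def dyadic (d : ℕ) (k : Fin d → ℕ) : Fin d → ℝ := fun i => ((2:ℝ) ^ (k i))⁻¹

/-- `|k|_1`. -/
def knorm1 (d : ℕ) (k : Fin d → ℕ) : ℝ := ∑ i, (k i : ℝ)

/-- `|k|_∞`. -/
def knormInf (d : ℕ) (k : Fin d → ℕ) : ℝ := ((Finset.univ.sup k : ℕ) : ℝ)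

/-- `Ω(t) = ∏ t_i^{a_i}` (mixed smoothness `a`). -/
def OmegaA (d : ℕ) (a : Fin d → ℝ) (t : Fin d → ℝ) : ℝ := ∏ i, t i ^ a i

/-- `Ω(t) = ∏ t_i^α · inf_j t_j^β` (β ≥ 0), resp. `∏ t_i^α · sup_j t_j^β` (β < 0). -/
def OmegaAB (d : ℕ) (α β : ℝ) (t : Fin d → ℝ) : ℝ :=
  if 0 ≤ β then (∏ i, t i ^ α) * ⨅ j, t j ^ β
  else (∏ i, t i ^ α) * ⨆ j, t j ^ β

/-- The centered cardinal B-spline of order `r` (`r`-fold convolution of the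
indicator of `[-1/2,1/2]`). -/
def centerB : ℕ → ℝ → ℝ
  | 0, _ => 0
  | 1, x => if -(1/2 : ℝ) ≤ x ∧ x < 1/2 then 1 else 0
  | (n + 2), x => ∫ y in (-(1/2) : ℝ)..(1/2 : ℝ), centerB (n + 1) (x - y)

/-- The `d`-variate B-spline `M^{(r)}_{k,s}` (integer translated dilations if `r` is even,
half-integer if `r` is odd). -/
def Mrks (d r : ℕ) (k : Fin d → ℕ) (s : Fin d → ℤ) (x : Fin d → ℝ) : ℝ :=
  ∏ i, centerB r ((2:ℝ) ^ (k i) * x i - (if Even r then (s i : ℝ) else (s i : ℝ) / 2))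

/-- `J_r^d(k)`: the set of `s` for which `M^{(r)}_{k,s}` does not vanish identically
on the cube. -/
def Jrd (d r : ℕ) (k : Fin d → ℕ) : Set (Fin d → ℤ) :=
  {s | ¬ ∀ x ∈ cube d, Mrks d r k s x = 0}

/-- `Σ_r^d(k)`: the span of the B-splines `M^{(r)}_{k,s}`, `s ∈ J_r^d(k)`. -/
def SigmaRd (d r : ℕ) (k : Fin d → ℕ) : Submodule ℝ ((Fin d → ℝ) → ℝ) :=
  Submodule.span ℝ (Mrks d r k '' Jrd d r k)

/-- The quasi-interpolation operator `Q(f,x) = ∑_s Λ(f,s) M(x-s)` on `ℝ`. -/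
def Qop (r m : ℕ) (lam : ℤ → ℝ) (f : ℝ → ℝ) (x : ℝ) : ℝ :=
  ∑' s : ℤ,
    (∑ j ∈ Finset.Icc (-(m:ℤ)) (m:ℤ), lam j * f ((s - j : ℤ) : ℝ)) * centerB r (x - (s:ℝ))

/-- `Q` is a quasi-interpolation operator: `lam` is even, supported in `|j| ≤ m`,
`m ≥ r/2 - 1`, and `Q` reproduces polynomials of degree at most `r-1`. -/
def QuasiInterp (r m : ℕ) (lam : ℤ → ℝ) : Prop :=
  (∀ j : ℤ, lam (-j) = lam j) ∧
  (∀ j : ℤ, (m : ℤ) < |j| → lam j = 0) ∧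
  ((r : ℝ) / 2 - 1 ≤ m) ∧
  (∀ P : Polynomial ℝ, P.natDegree < r →
    ∀ x : ℝ, Qop r m lam (fun y => Polynomial.eval y P) x = Polynomial.eval x P)

/-- The Lagrange extension `f̄_k` of a function on `[0,1]` to `ℝ`. -/
def extendF (r k : ℕ) (f : ℝ → ℝ) (x : ℝ) : ℝ :=
  if x < 0 then
    Polynomial.eval x (Lagrange.interpolate (Finset.range r) (fun j => (j : ℝ) / 2 ^ k)
      (fun j => f ((j : ℝ) / 2 ^ k)))
  else if x ≤ 1 then f x
  else
    Polynomial.eval x (Lagrange.interpolate (Finset.range r)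
      (fun j => ((2 ^ k : ℝ) - r + 1 + j) / 2 ^ k)
      (fun j => f (((2 ^ k : ℝ) - r + 1 + j) / 2 ^ k)))

/-- The coefficient functional `a_{k,s}(f)`. -/
def aks (r m : ℕ) (lam : ℤ → ℝ) (k : ℕ) (f : ℝ → ℝ) (s : ℤ) : ℝ :=
  ∑ j ∈ Finset.Icc (-(m:ℤ)) (m:ℤ), lam j * extendF r k f (((s - j : ℤ) : ℝ) / 2 ^ k)

/-- The boundary-corrected dyadic quasi-interpolation operator `Q_k` on `[0,1]`. -/
def Qb (r m : ℕ) (lam : ℤ → ℝ) (k : ℕ) (f : ℝ → ℝ) (x : ℝ) : ℝ :=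
  ∑' s : ℤ,
    if -(r : ℤ) < 2 * s ∧ 2 * s < 2 ^ (k + 1) + r then
      aks r m lam k f s * centerB r ((2:ℝ) ^ k * x - (s : ℝ))
    else 0

/-- `Q_k` applied in coordinate `i`. -/
def QbC (d r m : ℕ) (lam : ℤ → ℝ) (i : Fin d) (k : ℕ) (f : (Fin d → ℝ) → ℝ)
    (x : Fin d → ℝ) : ℝ :=
  Qb r m lam k (fun y => f (Function.update x i y)) (x i)

/-- `Q_k - Q_{k-1}` applied in coordinate `i` (with `Q_{-1} = 0`). -/
def qbDiffC (d r m : ℕ) (lam : ℤ → ℝ) (i : Fin d) (k : ℕ) (f : (Fin d → ℝ) → ℝ)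
    (x : Fin d → ℝ) : ℝ :=
  QbC d r m lam i k f x - (if k = 0 then 0 else QbC d r m lam i (k - 1) f x)

/-- The mixed operator `Q_k = ∏_i Q_{k_i}`. -/
def QMix (d r m : ℕ) (lam : ℤ → ℝ) (k : Fin d → ℕ) (f : (Fin d → ℝ) → ℝ) :
    (Fin d → ℝ) → ℝ :=
  (List.finRange d).foldr (fun i g => QbC d r m lam i (k i) g) f

/-- The mixed dyadic component `q_k = ∏_i (Q_{k_i} - Q_{k_i - 1})`. -/
def qMix (d r m : ℕ) (lam : ℤ → ℝ) (k : Fin d → ℕ) (f : (Fin d → ℝ) → ℝ) :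
    (Fin d → ℝ) → ℝ :=
  (List.finRange d).foldr (fun i g => qbDiffC d r m lam i (k i) g) f

/-- `R_Δ(f) = ∑_{k ∈ Δ} q_k(f)`. -/
def RDelta (d r m : ℕ) (lam : ℤ → ℝ) (Δ : Set (Fin d → ℕ)) (f : (Fin d → ℝ) → ℝ)
    (x : Fin d → ℝ) : ℝ :=
  ∑' k : Δ, qMix d r m lam k f x

/-- Convergence of the series `∑_{k ∈ ℤ_+^d} F_k` to `g` in the norm of `L_∞(𝕀^d)`. -/
def ConvLinf (d : ℕ) (F : (Fin d → ℕ) → (Fin d → ℝ) → ℝ) (g : (Fin d → ℝ) → ℝ) : Prop :=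
  Tendsto (fun Δ : Finset (Fin d → ℕ) =>
      eLpNorm (fun x => g x - ∑ k ∈ Δ, F k x) ∞ (volume.restrict (cube d)))
    atTop (nhds 0)

/-- The quantity `B_4({g_k}) = (∑_k {‖g_k‖_p / Ω(2^{-k})}^θ)^{1/θ}`. -/
def B4seq (d : ℕ) (p θ : ℝ≥0∞) (Ω : (Fin d → ℝ) → ℝ)
    (gk : (Fin d → ℕ) → (Fin d → ℝ) → ℝ) : ℝ≥0∞ :=
  if θ = ∞ then ⨆ k : Fin d → ℕ, lpQ d p (gk k) / ENNReal.ofReal (Ω (dyadic d k))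
  else (∑' k : Fin d → ℕ,
      (lpQ d p (gk k) / ENNReal.ofReal (Ω (dyadic d k))) ^ θ.toReal) ^ (1 / θ.toReal)

/-- The quantity `B_2(f) = (∑_k {‖q_k(f)‖_p / Ω(2^{-k})}^θ)^{1/θ}`. -/
def B2 (d r m : ℕ) (lam : ℤ → ℝ) (p θ : ℝ≥0∞) (Ω : (Fin d → ℝ) → ℝ)
    (f : (Fin d → ℝ) → ℝ) : ℝ≥0∞ :=
  B4seq d p θ Ω (fun k => qMix d r m lam k f)

/-- The quasi-norm `‖f‖_{B^ψ_{p,θ}} = (∑_k (2^{ψ(k)} ‖q_k f‖_p)^θ)^{1/θ}`. -/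
def bpsiNorm (d r m : ℕ) (lam : ℤ → ℝ) (ψ : (Fin d → ℕ) → ℝ) (p θ : ℝ≥0∞)
    (f : (Fin d → ℝ) → ℝ) : ℝ≥0∞ :=
  if θ = ∞ then
    ⨆ k : Fin d → ℕ, ENNReal.ofReal ((2:ℝ) ^ (ψ k)) * lpQ d p (qMix d r m lam k f)
  else (∑' k : Fin d → ℕ,
      (ENNReal.ofReal ((2:ℝ) ^ (ψ k)) * lpQ d p (qMix d r m lam k f)) ^ θ.toReal) ^
    (1 / θ.toReal)

/-- `I^d(k) = {s ∈ ℤ_+^d : 0 ≤ s_i ≤ 2^{k_i}}`. -/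
def IdkF (d : ℕ) (k : Fin d → ℕ) : Finset (Fin d → ℕ) :=
  Fintype.piFinset fun i => Finset.range (2 ^ (k i) + 1)

/-- The dyadic grid point `2^{-k} s`. -/
def gridPt (d : ℕ) (k : Fin d → ℕ) (s : Fin d → ℕ) : Fin d → ℝ :=
  fun i => (s i : ℝ) / 2 ^ (k i)

/-- `|G(Δ)| = ∑_{k ∈ Δ} ∏_j (2^{k_j} + 1)`, counted with multiplicity. -/
def gridSizeE (d : ℕ) (Δ : Set (Fin d → ℕ)) : ℝ≥0∞ :=
  ∑' k : Δ, ∏ i, ((2:ℝ≥0∞) ^ ((k : Fin d → ℕ) i) + 1)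

/-- `∑_{k ∈ Δ} 2^{|k|_1}`. -/
def sum2E (d : ℕ) (Δ : Set (Fin d → ℕ)) : ℝ≥0∞ :=
  ∑' k : Δ, (2:ℝ≥0∞) ^ (∑ i, (k : Fin d → ℕ) i)

/-- The set `A` of triples `(p,θ,q)`. -/
def tripleA (p θ q : ℝ≥0∞) : Prop :=
  (q ≤ p ∧ θ ≤ min q 1) ∨ (p < q ∧ q < ∞ ∧ θ ≤ q) ∨ (p < q ∧ q = ∞ ∧ θ ≤ 1)

/-- `(1/p - 1/q)_+`. -/
def rhoPQ (p q : ℝ≥0∞) : ℝ := max 0 (p⁻¹.toReal - q⁻¹.toReal)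

/-- The sparse index set `Δ(ξ)` for the classes `U^{α,β}_{p,θ}`. -/
def DeltaAB (d : ℕ) (p θ q : ℝ≥0∞) (α β ε : ℝ) (ξ : ℝ) : Set (Fin d → ℕ) :=
  if tripleA p θ q then
    {k | (α - rhoPQ p q) * knorm1 d k + β * knormInf d k ≤ ξ}
  else if 0 < β then
    {k | (α - rhoPQ p q + ε / d) * knorm1 d k + (β - ε) * knormInf d k ≤ ξ}
  else
    {k | (α - rhoPQ p q - ε) * knorm1 d k + (β + ε) * knormInf d k ≤ ξ}

/-- The sparse index set `Δ'(ξ)` for the classes `U^a_{p,θ}`. -/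
def DeltaA (d : ℕ) (p θ q : ℝ≥0∞) (a : Fin d → ℝ) (ε : ℝ) (ξ : ℝ) : Set (Fin d → ℕ) :=
  if tripleA p θ q then
    {k | (∑ i, a i * (k i : ℝ)) - rhoPQ p q * knorm1 d k ≤ ξ}
  else
    {k | (∑ i : Fin d, (if i.val = 0 then a i else a i - ε) * (k i : ℝ))
          - rhoPQ p q * knorm1 d k ≤ ξ}

/-- The sparse index set `Δ''(ξ)` for recovery in the energy norm. -/
def DeltaG (d : ℕ) (p q θ τ : ℝ≥0∞) (α β γ ε : ℝ) (ξ : ℝ) : Set (Fin d → ℕ) :=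
  if θ ≤ min τ 1 then
    {k | (α - rhoPQ p q) * knorm1 d k - (γ - β) * knormInf d k ≤ ξ}
  else if γ < β then
    {k | (α - rhoPQ p q + ε / d) * knorm1 d k - (γ - β - ε) * knormInf d k ≤ ξ}
  else
    {k | (α - rhoPQ p q - ε) * knorm1 d k - (γ - β + ε) * knormInf d k ≤ ξ}

/-- The unit ball of `B^Ω_{p,θ}` (of continuous functions). -/
def Uball (d r : ℕ) (p θ : ℝ≥0∞) (Ω : (Fin d → ℝ) → ℝ) : Set ((Fin d → ℝ) → ℝ) :=
  {f | ContinuousOn f (cube d) ∧ besovNorm d r p θ Ω f ≤ 1}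

/-- The quantity `r_n(W, ·)` of optimal linear sampling recovery. -/
def rW (d n : ℕ) (W : Set ((Fin d → ℝ) → ℝ)) (nrm : ((Fin d → ℝ) → ℝ) → ℝ≥0∞) : ℝ≥0∞ :=
  ⨅ (X : Fin n → Fin d → ℝ) (_ : ∀ j, X j ∈ cube d) (Φ : Fin n → (Fin d → ℝ) → ℝ),
    ⨆ f ∈ W, nrm (fun x => f x - ∑ j, f (X j) * Φ j x)

/-- The quantity `ϱ_n(W, ·)` of optimal (nonlinear) sampling recovery. -/
def rhoW (d n : ℕ) (W : Set ((Fin d → ℝ) → ℝ)) (nrm : ((Fin d → ℝ) → ℝ) → ℝ≥0∞) : ℝ≥0∞ :=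
  ⨅ (X : Fin n → Fin d → ℝ) (_ : ∀ j, X j ∈ cube d) (P : (Fin n → ℝ) → (Fin d → ℝ) → ℝ),
    ⨆ f ∈ W, nrm (fun x => f x - P (fun j => f (X j)) x)

/-- The quantity `i_n(W)` of optimal cubature. -/
def iW (d n : ℕ) (W : Set ((Fin d → ℝ) → ℝ)) : ℝ≥0∞ :=
  ⨅ (X : Fin n → Fin d → ℝ) (_ : ∀ j, X j ∈ cube d) (Λ : Fin n → ℝ),
    ⨆ f ∈ W, ENNReal.ofReal |(∫ x in cube d, f x) - ∑ j, Λ j * f (X j)|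

/-- `R_Δ` is a linear sampling algorithm on the grid `G(Δ)`. -/
def IsSamplingAlg (d r m : ℕ) (lam : ℤ → ℝ) (Δ : Set (Fin d → ℕ)) : Prop :=
  ∃ ψ : (Fin d → ℕ) → (Fin d → ℕ) → (Fin d → ℝ) → ℝ,
    ∀ f : (Fin d → ℝ) → ℝ, ContinuousOn f (cube d) → ∀ x ∈ cube d,
      RDelta d r m lam Δ f x =
        ∑' k : Δ, ∑ s ∈ IdkF d (k : Fin d → ℕ), f (gridPt d (k : Fin d → ℕ) s) * ψ k s x

/-- The discrete quasi-norm `B_1(f)`. -/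
def B1 (d r : ℕ) (p θ : ℝ≥0∞) (Ω : (Fin d → ℝ) → ℝ) (f : (Fin d → ℝ) → ℝ) : ℝ≥0∞ :=
  ∑ e : Finset (Fin d),
    if θ = ∞ then
      ⨆ (k : Fin d → ℕ) (_ : ∀ i ∉ e, k i = 0),
        modulus d r e p f (dyadic d k) / ENNReal.ofReal (Ω (dyadic d k))
    else
      (∑' k : Fin d → ℕ,
          if ∀ i ∉ e, k i = 0 then
            (modulus d r e p f (dyadic d k) / ENNReal.ofReal (Ω (dyadic d k))) ^ θ.toReal
          else 0) ^ (1 / θ.toReal)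

end SparseGrid


namespace SparseGrid

/-- Truncated power. -/
def tp (n : ℕ) (x : ℝ) : ℝ := if 0 ≤ x then x ^ n else 0

lemma tp_measurable (n : ℕ) : Measurable (tp n) :=
  Measurable.ite measurableSet_Ici (by fun_prop) measurable_const

/-- Univariate spans of truncated powers with half-integer knots at level `k`. -/
def TS (k n : ℕ) : Submodule ℝ (ℝ → ℝ) :=
  Submodule.span ℝ (Set.range fun (z : ℤ) (x : ℝ) => tp n ((2:ℝ) ^ k * x - z / 2))

lemma TS_measurable {k n : ℕ} {f : ℝ → ℝ} (hf : f ∈ TS k n) : Measurable f := by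
  induction hf using Submodule.span_induction with
  | mem x h =>
    obtain ⟨z, rfl⟩ := h
    exact (tp_measurable n).comp (by fun_prop)
  | zero => exact measurable_const
  | add x y _ _ hx hy => exact hx.add hy
  | smul a x _ hx => exact hx.const_smul a

lemma tp_succ_hasDerivAt (n : ℕ) (x : ℝ) (hx : x ≠ 0) :
    HasDerivAt (tp (n + 1)) ((n + 1) * tp n x) x := by
  rcases lt_or_gt_of_ne hx with h | h
  · have : tp (n+1) =ᶠ[nhds x] fun _ => 0 := by
      filter_upwards [gt_mem_nhds h] with y hy
      simp [tp, not_le.2 hy]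
    rw [show tp n x = 0 by simp [tp, not_le.2 h], mul_zero]
    exact (hasDerivAt_const x (0:ℝ)).congr_of_eventuallyEq this
  · have : tp (n+1) =ᶠ[nhds x] fun y => y ^ (n+1) := by
      filter_upwards [lt_mem_nhds h] with y hy
      simp [tp, hy.le]
    rw [show tp n x = x ^ n by simp [tp, h.le]]
    have := (hasDerivAt_pow (n+1) x).congr_of_eventuallyEq this
    simpa using this

lemma tp_monotone (n : ℕ) : Monotone (tp n) := by
  intro x y hxy
  unfold tp
  split_ifs with h1 h2
  · gcongr
  · exact absurd (h1.trans hxy) h2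
  · positivity
  · exact le_rfl

lemma tp_intervalIntegrable (n : ℕ) (a b : ℝ) : IntervalIntegrable (tp n) volume a b :=
  (tp_monotone n).intervalIntegrable

lemma tp_continuous (n : ℕ) : Continuous (tp (n+1)) := by
  have : tp (n+1) = fun x => (max x 0) ^ (n+1) := by
    ext x
    unfold tp
    split_ifs with h
    · rw [max_eq_left h]
    · rw [max_eq_right (not_le.1 h).le]; simp
  rw [this]; fun_prop

lemma tp_integral (n : ℕ) (a b : ℝ) :
    ∫ y in a..b, tp n y = (tp (n+1) b - tp (n+1) a) / (n+1) := by
  have hn : ((n:ℝ)+1) ≠ 0 := by positivity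
  have key : ∫ y in a..b, ((n:ℝ)+1) * tp n y = tp (n+1) b - tp (n+1) a := by
    refine integral_eq_of_hasDerivAt_off_countable (s := {0}) (tp (n+1)) _
      (Set.countable_singleton 0) (tp_continuous n).continuousOn ?_ ?_
    · rintro x ⟨_, hx⟩
      exact tp_succ_hasDerivAt n x (by simpa using hx)
    · exact (tp_intervalIntegrable n a b).const_mul _
  rw [intervalIntegral.integral_const_mul] at key
  rw [← key]; field_simp

/-- Integration over a unit window maps splines to splines of the next order. -/
lemma TS_integral {n : ℕ} {f : ℝ → ℝ} (hf : f ∈ TS 0 n) :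
    (∀ a b x : ℝ, IntervalIntegrable (fun y => f (x - y)) volume a b) ∧
      (fun x => ∫ y in (-(1/2) : ℝ)..(1/2 : ℝ), f (x - y)) ∈ TS 0 (n+1) := by
  induction hf using Submodule.span_induction with
  | mem g h =>
    obtain ⟨z, rfl⟩ := h
    constructor
    · intro a b x
      have := (tp_intervalIntegrable n (x - z/2 - a) (x - z/2 - b)).comp_sub_left (x - z/2)
      simp only [sub_sub_cancel] at this
      convert this using 2
      ring_nf
    · have : (fun x => ∫ y in (-(1/2) : ℝ)..(1/2 : ℝ), tp n ((2:ℝ)^0 * (x - y) - z/2)) =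
        ((1:ℝ)/(n+1)) • ((fun x => tp (n+1) ((2:ℝ)^0 * x - ((z-1 : ℤ):ℝ)/2)) -
          (fun x => tp (n+1) ((2:ℝ)^0 * x - ((z+1 : ℤ):ℝ)/2))) := by
        ext x
        have h1 : (∫ y in (-(1/2) : ℝ)..(1/2 : ℝ), tp n ((2:ℝ)^0 * (x - y) - z/2)) =
            ∫ y in (-(1/2) : ℝ)..(1/2 : ℝ), tp n ((x - z/2) - y) := by
          congr 1; ext y; ring_nf
        rw [h1, intervalIntegral.integral_comp_sub_left (fun y => tp n y), tp_integral]
        simp only [Pi.smul_apply, Pi.sub_apply, smul_eq_mul, pow_zero, one_mul]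
        push_cast
        rw [show x - ((z:ℝ) - 1)/2 = x - z/2 - -(1/2) by ring,
          show x - ((z:ℝ) + 1)/2 = x - z/2 - 1/2 by ring]
        ring
      rw [this]
      exact Submodule.smul_mem _ _ (Submodule.sub_mem _ (Submodule.subset_span ⟨_, rfl⟩)
        (Submodule.subset_span ⟨_, rfl⟩))
  | zero =>
    refine ⟨fun a b x => by simp, ?_⟩
    have h0 : (fun x : ℝ => ∫ y in (-(1/2) : ℝ)..(1/2 : ℝ), (0 : ℝ → ℝ) (x - y)) = 0 := by
      ext x; simp
    rw [h0]
    exact Submodule.zero_mem _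
  | add f g _ _ hf hg =>
    refine ⟨fun a b x => (hf.1 a b x).add (hg.1 a b x), ?_⟩
    convert Submodule.add_mem _ hf.2 hg.2 using 1
    ext x
    exact intervalIntegral.integral_add (hf.1 _ _ x) (hg.1 _ _ x)
  | smul a f _ hf =>
    refine ⟨fun c b x => (hf.1 c b x).const_mul a, ?_⟩
    convert Submodule.smul_mem _ a hf.2 using 1
    ext x
    exact intervalIntegral.integral_const_mul _ _

lemma centerB_mem (n : ℕ) : centerB (n+1) ∈ TS 0 n := by
  induction n with
  | zero =>
    have : centerB (0+1) = (fun x => tp 0 ((2:ℝ)^0 * x - ((-1 : ℤ):ℝ)/2)) -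
          (fun x => tp 0 ((2:ℝ)^0 * x - ((1 : ℤ):ℝ)/2)) := by
      ext x
      simp only [centerB, tp, Pi.sub_apply, pow_zero, one_mul]
      push_cast
      split_ifs <;> first | (norm_num; done) | (exfalso; grind)
    rw [this]
    exact Submodule.sub_mem _ (Submodule.subset_span ⟨_, rfl⟩)
        (Submodule.subset_span ⟨_, rfl⟩)
  | succ n ih =>
    have := (TS_integral ih).2
    have h2 : centerB (n + 1 + 1) = fun x => ∫ y in (-(1/2) : ℝ)..(1/2 : ℝ), centerB (n+1) (x - y) := by
      ext x; rw [centerB]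
    rw [h2]; exact this

lemma TS_comp {n k : ℕ} {f : ℝ → ℝ} (hf : f ∈ TS 0 n) (q : ℤ) :
    (fun x => f ((2:ℝ)^k * x - q/2)) ∈ TS k n := by
  induction hf using Submodule.span_induction with
  | mem g h =>
    obtain ⟨z, rfl⟩ := h
    refine Submodule.subset_span ⟨q + z, ?_⟩
    ext x
    push_cast
    congr 1
    ring
  | zero => exact Submodule.zero_mem _
  | add f g _ _ hf hg => exact Submodule.add_mem _ hf hg
  | smul a f _ hf => exact Submodule.smul_mem _ a hf

lemma centerB_comp_mem (r k : ℕ) (hr : 0 < r) (s : ℤ) :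
    (fun x => centerB r ((2:ℝ)^k * x - (if Even r then (s:ℝ) else (s:ℝ)/2))) ∈ TS k (r-1) := by
  obtain ⟨n, rfl⟩ : ∃ n, r = n + 1 := ⟨r - 1, by omega⟩
  rw [Nat.add_sub_cancel]
  split_ifs
  · convert TS_comp (k := k) (centerB_mem n) (2 * s) using 4
    push_cast; ring
  · exact TS_comp (centerB_mem n) s

lemma Sigma_section {d r : ℕ} (hr : 0 < r) {k : Fin d → ℕ} {G : (Fin d → ℝ) → ℝ}
    (hG : G ∈ SigmaRd d r k) (i : Fin d) (x : Fin d → ℝ) :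
    (fun y => G (Function.update x i y)) ∈ TS (k i) (r-1) := by
  induction hG using Submodule.span_induction with
  | mem g h =>
    obtain ⟨s, _, rfl⟩ := h
    have : (fun y => Mrks d r k s (Function.update x i y)) =
      (∏ j ∈ Finset.univ.erase i,
        centerB r ((2:ℝ) ^ (k j) * x j - (if Even r then (s j : ℝ) else (s j : ℝ) / 2))) •
      (fun y => centerB r ((2:ℝ)^(k i) * y - (if Even r then (s i:ℝ) else (s i:ℝ)/2))) := by
      ext y
      simp only [Mrks, Pi.smul_apply, smul_eq_mul]
      rw [← Finset.mul_prod_erase _ _ (Finset.mem_univ i), mul_comm]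
      congr 1
      · refine Finset.prod_congr rfl fun j hj => ?_
        rw [Function.update_of_ne (Finset.ne_of_mem_erase hj)]
      · rw [Function.update_self]
    rw [this]
    exact Submodule.smul_mem _ _ (centerB_comp_mem r (k i) hr (s i))
  | zero => exact Submodule.zero_mem _
  | add f g _ _ hf hg => exact Submodule.add_mem _ hf hg
  | smul a f _ hf => exact Submodule.smul_mem _ a hf

lemma Sigma_measurable {d r : ℕ} (hr : 0 < r) {k : Fin d → ℕ} {G : (Fin d → ℝ) → ℝ}
    (hG : G ∈ SigmaRd d r k) : Measurable G := by
  induction hG using Submodule.span_induction with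
  | mem g h =>
    obtain ⟨s, _, rfl⟩ := h
    unfold Mrks
    refine Finset.measurable_prod _ fun i _ => ?_
    exact (TS_measurable (centerB_comp_mem r (k i) hr (s i))).comp (measurable_pi_apply i)
  | zero => exact measurable_const
  | add f g _ _ hf hg => exact hf.add hg
  | smul a f _ hf => exact hf.const_smul a

/-- univariate difference -/
def diff1 (r : ℕ) (h : ℝ) (f : ℝ → ℝ) (x : ℝ) : ℝ :=
  ∑ j ∈ Finset.range (r + 1), (-1 : ℝ) ^ (r - j) * (r.choose j : ℝ) * f (x + j * h)

/-- Differences of order `r` annihilate powers below `r`. -/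
lemma diff_pow_zero (r n : ℕ) (hn : n < r) (a h : ℝ) :
    ∑ j ∈ Finset.range (r + 1), (-1 : ℝ) ^ (r - j) * (r.choose j : ℝ) * (a + j * h) ^ n = 0 := by
  have hb : ∀ j : ℝ, (a + j * h)^n = ∑ m ∈ Finset.range (n+1), (h^m * a^(n-m) * n.choose m) * j^m := by
    intro j
    rw [add_comm, add_pow]
    refine Finset.sum_congr rfl fun m _ => by rw [mul_pow]; ring
  simp_rw [hb, Finset.mul_sum]
  rw [Finset.sum_comm]
  refine Finset.sum_eq_zero fun m hm => ?_
  have hm' : m < r := by simp at hm; omega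
  have := congrFun (fwdDiff_iter_pow_eq_zero_of_lt (R := ℝ) hm') 0
  rw [fwdDiff_iter_eq_sum_shift] at this
  simp only [zero_add, nsmul_eq_mul, mul_one, zsmul_eq_mul, Pi.zero_apply] at this
  push_cast at this
  calc _ = (h^m * a^(n-m) * n.choose m) * ∑ j ∈ Finset.range (r + 1), (-1 : ℝ) ^ (r - j) * (r.choose j : ℝ) * (j:ℝ)^m := by
        rw [Finset.mul_sum]; refine Finset.sum_congr rfl fun j _ => by ring
    _ = 0 := by rw [this, mul_zero]

lemma eLpNorm_add_rpow_le {α : Type*} [MeasurableSpace α] {ν : Measure α} {p : ℝ≥0∞} {τ : ℝ}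
    (hτ : 0 < τ) (hτ1 : τ ≤ 1) (hτp : ENNReal.ofReal τ ≤ p) {f g : α → ℝ}
    (hf : AEStronglyMeasurable f ν) (hg : AEStronglyMeasurable g ν) :
    eLpNorm (fun x => f x + g x) p ν ^ τ ≤ eLpNorm f p ν ^ τ + eLpNorm g p ν ^ τ := by
  rcases le_total 1 p with hp | hp
  · calc _ ≤ (eLpNorm f p ν + eLpNorm g p ν) ^ τ := by
          gcongr; exact eLpNorm_add_le hf hg hp
      _ ≤ _ := ENNReal.rpow_add_le_add_rpow _ _ hτ.le hτ1
  · have hp0 : p ≠ 0 := by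
      rintro rfl
      simp at hτp; linarith
    have hpt : p ≠ ∞ := ne_top_of_le_ne_top ENNReal.one_ne_top hp
    have hq : 0 < p.toReal := ENNReal.toReal_pos hp0 hpt
    have hq1 : p.toReal ≤ 1 := by simpa using ENNReal.toReal_mono ENNReal.one_ne_top hp
    have hτq : τ ≤ p.toReal := by
      rw [← ENNReal.toReal_ofReal hτ.le]; exact ENNReal.toReal_mono hpt hτp
    simp only [eLpNorm_eq_lintegral_rpow_enorm_toReal hp0 hpt, ← ENNReal.rpow_mul]
    have h1 : 0 ≤ 1 / p.toReal * τ := by positivity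
    have h2 : 1 / p.toReal * τ ≤ 1 := by
      rw [one_div, inv_mul_le_iff₀ hq]; linarith
    refine le_trans ?_ (ENNReal.rpow_add_le_add_rpow _ _ h1 h2)
    refine ENNReal.rpow_le_rpow ?_ h1
    rw [← lintegral_add_left' (by exact hf.enorm.pow_const _)]
    refine lintegral_mono fun x => ?_
    calc ‖f x + g x‖ₑ ^ p.toReal ≤ (‖f x‖ₑ + ‖g x‖ₑ) ^ p.toReal := by
          gcongr; exact enorm_add_le _ _
      _ ≤ _ := ENNReal.rpow_add_le_add_rpow _ _ hq.le hq1

lemma eLpNorm_sum_rpow_le {α ι : Type*} [MeasurableSpace α] {ν : Measure α} {p : ℝ≥0∞} {τ : ℝ}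
    (hτ : 0 < τ) (hτ1 : τ ≤ 1) (hτp : ENNReal.ofReal τ ≤ p) (s : Finset ι) (f : ι → α → ℝ)
    (hf : ∀ i, AEStronglyMeasurable (f i) ν) :
    eLpNorm (fun x => ∑ i ∈ s, f i x) p ν ^ τ ≤ ∑ i ∈ s, eLpNorm (f i) p ν ^ τ := by
  induction s using Finset.induction_on with
  | empty => simp [hτ]
  | insert a s ha ih =>
    simp only [Finset.sum_insert ha]
    refine le_trans (eLpNorm_add_rpow_le hτ hτ1 hτp (hf a) ?_) (by gcongr)
    exact Finset.aestronglyMeasurable_fun_sum s fun i _ => hf i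

/-- Fubini comparison in one coordinate. -/
lemma eLpNorm_le_of_section {d : ℕ} {p : ℝ≥0∞} (hp : p ≠ 0) (i : Fin d) {f g : (Fin d → ℝ) → ℝ}
    (hf : Measurable f) (hg : Measurable g) (K : ℝ≥0∞) (hK : K ≠ ∞)
    (h : ∀ x : Fin d → ℝ, eLpNorm (fun y => f (Function.update x i y)) p volume ≤
      K * eLpNorm (fun y => g (Function.update x i y)) p volume) :
    eLpNorm f p volume ≤ K * eLpNorm g p volume := by
  by_cases hpt : p = ∞
  · subst hpt
    simp only [eLpNorm_exponent_top] at *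
    set A := eLpNormEssSup g volume with hA
    have hgA : ∀ᵐ x, ‖g x‖ₑ ≤ A := enorm_ae_le_eLpNormEssSup g volume
    have key : ∫⁻ x, (if K * A < ‖f x‖ₑ then 1 else 0) ≤ ∫⁻ x, (if A < ‖g x‖ₑ then ∞ else 0) := by
      refine lintegral_le_of_lmarginal_le (μ := fun _ => volume) {i} ?_ ?_ ?_
      · exact Measurable.ite (measurableSet_lt measurable_const hf.enorm) measurable_const
          measurable_const
      · exact Measurable.ite (measurableSet_lt measurable_const hg.enorm) measurable_const
          measurable_const
      · intro x
        rw [lmarginal_singleton, lmarginal_singleton]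
        simp only
        have hm : Measurable (Function.update x i) := measurable_update x
        have hms : MeasurableSet {y | A < ‖g (Function.update x i y)‖ₑ} :=
          measurableSet_lt measurable_const (hg.comp hm).enorm
        by_cases hc : ∀ᵐ y, ‖g (Function.update x i y)‖ₑ ≤ A
        · have h1 : eLpNormEssSup (fun y => g (Function.update x i y)) volume ≤ A :=
            essSup_le_of_ae_le _ hc
          have h2 : ∀ᵐ y, ‖f (Function.update x i y)‖ₑ ≤ K * A := by
            filter_upwards [enorm_ae_le_eLpNormEssSup (fun y => f (Function.update x i y)) volume]
              with y hy
            exact hy.trans ((h x).trans (by gcongr))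
          rw [lintegral_eq_zero_of_ae_eq_zero]
          · exact bot_le
          · filter_upwards [h2] with y hy
            simp [not_lt.2 hy]
        · have h3 : volume {y | A < ‖g (Function.update x i y)‖ₑ} ≠ 0 := by
            intro h0
            apply hc
            rw [ae_iff]
            simpa using h0
          have : ∫⁻ y, (if A < ‖g (Function.update x i y)‖ₑ then ∞ else 0) = ∞ := by
            have : ∫⁻ y, (if A < ‖g (Function.update x i y)‖ₑ then (∞:ℝ≥0∞) else 0) =
              ∫⁻ y, Set.indicator {y | A < ‖g (Function.update x i y)‖ₑ} (fun _ => ∞) y := by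
              congr 1; ext y; rw [Set.indicator_apply]; rfl
            rw [this, lintegral_indicator hms, setLIntegral_const, ENNReal.top_mul h3]
          rw [this]; exact le_top
    have hz : ∫⁻ x, (if A < ‖g x‖ₑ then (∞ : ℝ≥0∞) else 0) = 0 := by
      apply lintegral_eq_zero_of_ae_eq_zero
      filter_upwards [hgA] with x hx
      simp [not_lt.2 hx]
    rw [hz, nonpos_iff_eq_zero, lintegral_eq_zero_iff] at key
    · refine essSup_le_of_ae_le _ ?_
      filter_upwards [key] with x hx
      by_contra hc
      simp [not_le.1 hc] at hx
    · exact Measurable.ite (measurableSet_lt measurable_const hf.enorm) measurable_const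
          measurable_const
  · have hq : 0 < p.toReal := ENNReal.toReal_pos hp hpt
    simp only [eLpNorm_eq_lintegral_rpow_enorm_toReal hp hpt] at *
    have hconv : ∀ X Y : ℝ≥0∞, X ^ (1/p.toReal) ≤ K * Y ^ (1/p.toReal) ↔ X ≤ K ^ p.toReal * Y := by
      intro X Y
      rw [← ENNReal.rpow_le_rpow_iff hq, ENNReal.mul_rpow_of_nonneg _ _ hq.le, ← ENNReal.rpow_mul,
        ← ENNReal.rpow_mul, one_div_mul_cancel hq.ne', ENNReal.rpow_one, ENNReal.rpow_one]
    rw [hconv]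
    simp only [hconv] at h
    have hK' : K ^ p.toReal ≠ ∞ := ENNReal.rpow_ne_top_of_nonneg hq.le hK
    rw [← lintegral_const_mul' _ _ hK']
    refine lintegral_le_of_lmarginal_le (μ := fun _ => volume) {i} ?_ ?_ ?_
    · exact hf.enorm.pow_const _
    · exact (hg.enorm.pow_const _).const_mul _
    · intro x
      rw [lmarginal_singleton, lmarginal_singleton]
      simp only
      rw [lintegral_const_mul' _ _ hK']
      exact h x

lemma poly_lower (r : ℕ) (hr : 0 < r) (q : ℝ) (hq : 0 < q) :
    ∃ K > (0:ℝ), ∀ c : Fin r → ℝ,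
      ‖c‖ ^ q ≤ K * ∫ x in (0:ℝ)..1, |∑ i, c i * x ^ (i:ℕ)| ^ q := by
  set Φ : (Fin r → ℝ) → ℝ := fun c => ∫ x in (0:ℝ)..1, |∑ i, c i * x ^ (i:ℕ)| ^ q with hΦ
  have hjc : Continuous (Function.uncurry fun (c : Fin r → ℝ) (x : ℝ) => |∑ i, c i * x ^ (i:ℕ)| ^ q) := by
    refine Continuous.rpow_const ?_ fun _ => Or.inr hq.le
    fun_prop
  have hcont : Continuous Φ :=
    intervalIntegral.continuous_parametric_intervalIntegral_of_continuous' hjc 0 1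
  have : Nonempty (Fin r) := ⟨⟨0, hr⟩⟩
  have hne : (Metric.sphere (0 : Fin r → ℝ) 1).Nonempty := NormedSpace.sphere_nonempty.2 zero_le_one
  obtain ⟨c0, hc0, hmin⟩ := (isCompact_sphere (0 : Fin r → ℝ) 1).exists_isMinOn hne hcont.continuousOn
  have hpos : 0 < Φ c0 := by
    have hx : ∃ x ∈ Set.Icc (0:ℝ) 1, ∑ i, c0 i * x ^ (i:ℕ) ≠ 0 := by
      by_contra hcon
      push Not at hcon
      set P : Polynomial ℝ := ∑ i : Fin r, Polynomial.C (c0 i) * Polynomial.X ^ (i:ℕ) with hP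
      have hP0 : P = 0 := by
        apply Polynomial.eq_zero_of_infinite_isRoot
        refine Set.Infinite.mono ?_ (Set.Icc_infinite (zero_lt_one' ℝ))
        intro x hx
        simp only [Set.mem_ofPred_eq, Polynomial.IsRoot, hP, Polynomial.eval_finsetSum,
          Polynomial.eval_mul, Polynomial.eval_C, Polynomial.eval_pow, Polynomial.eval_X]
        exact hcon x hx
      have : c0 = 0 := by
        ext i
        have h1 : P.coeff i = c0 i := by
          simp [hP, Polynomial.finsetSum_coeff, Polynomial.coeff_X_pow, Fin.val_inj]
        rw [← h1, hP0]; simp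
      rw [this] at hc0
      simp at hc0
    obtain ⟨x, hx, hxne⟩ := hx
    refine intervalIntegral.integral_pos zero_lt_one ?_ ?_ ⟨x, hx, ?_⟩
    · exact (hjc.comp (by fun_prop : Continuous fun x : ℝ => (c0, x))).continuousOn
    · intro x _; positivity
    · positivity
  refine ⟨(Φ c0)⁻¹, inv_pos.2 hpos, fun c => ?_⟩
  by_cases hc : c = 0
  · subst hc
    simp [hq.ne']
  have hn : 0 < ‖c‖ := norm_pos_iff.2 hc
  have hu : ‖c‖⁻¹ • c ∈ Metric.sphere (0 : Fin r → ℝ) 1 := by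
    simp [norm_smul, hn.ne']
  have h1 : Φ c0 ≤ Φ (‖c‖⁻¹ • c) := hmin hu
  have h2 : Φ (‖c‖⁻¹ • c) = (‖c‖⁻¹) ^ q * Φ c := by
    simp only [hΦ]
    rw [← intervalIntegral.integral_const_mul]
    congr 1; ext x
    rw [← Real.mul_rpow (by positivity) (abs_nonneg _)]
    congr 1
    rw [← abs_of_pos (inv_pos.2 hn), ← abs_mul, Finset.mul_sum, abs_of_pos (inv_pos.2 hn)]
    simp [mul_assoc]
  rw [h2, Real.inv_rpow hn.le] at h1
  rw [inv_mul_eq_div, le_div_iff₀ hpos]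
  rw [inv_mul_eq_div, le_div_iff₀ (by positivity)] at h1
  linarith

lemma poly_lower_fin (r : ℕ) (p : ℝ≥0∞) (hp : p ≠ 0) (hpt : p ≠ ∞) :
    ∃ K : NNReal, ∀ P : Polynomial ℝ, P.natDegree < r → 
      ‖P.coeff (r-1)‖ₑ ≤ K * eLpNorm (fun x => P.eval x) p (volume.restrict (Set.Ico 0 1)) := by
  rcases Nat.eq_zero_or_pos r with hr | hr
  · exact ⟨0, fun P hP => by omega⟩
  have hq : 0 < p.toReal := ENNReal.toReal_pos hp hpt
  obtain ⟨K, hK, h⟩ := poly_lower r hr p.toReal hq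
  refine ⟨(K ^ (1 / p.toReal)).toNNReal, fun P hP => ?_⟩
  have h1 := h fun i => P.coeff i
  have he : ∀ x, ∑ i : Fin r, P.coeff i * x ^ (i:ℕ) = P.eval x := by
    intro x
    rw [Polynomial.eval_eq_sum_range' hP, Finset.sum_range]
  simp only [he] at h1
  have hc : ‖P.coeff (r-1)‖ ≤ ‖fun i : Fin r => P.coeff i‖ :=
    norm_le_pi_norm (fun i : Fin r => P.coeff i) ⟨r-1, by omega⟩
  have h2 : ‖P.coeff (r-1)‖ ^ p.toReal ≤ K * ∫ x in (0:ℝ)..1, |P.eval x| ^ p.toReal :=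
    le_trans (by gcongr) h1
  rw [eLpNorm_eq_lintegral_rpow_enorm_toReal hp hpt]
  rw [← ENNReal.rpow_le_rpow_iff hq, ENNReal.mul_rpow_of_nonneg _ _ hq.le, ← ENNReal.rpow_mul,
     one_div_mul_cancel hq.ne', ENNReal.rpow_one]
  have h3 : ((K ^ (1 / p.toReal)).toNNReal : ℝ≥0∞) ^ p.toReal = ENNReal.ofReal K := by
    change ENNReal.ofReal _ ^ _ = _
    rw [ENNReal.ofReal_rpow_of_nonneg (by positivity) hq.le, ← Real.rpow_mul hK.le,
      one_div_mul_cancel hq.ne', Real.rpow_one]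
  have h4 : ∫⁻ x in Set.Ico (0:ℝ) 1, ‖P.eval x‖ₑ ^ p.toReal =
      ENNReal.ofReal (∫ x in (0:ℝ)..1, |P.eval x| ^ p.toReal) := by
    rw [intervalIntegral.integral_of_le zero_le_one, ← integral_Ico_eq_integral_Ioc]
    rw [ofReal_integral_eq_lintegral_ofReal]
    · congr 1; ext x
      rw [← Real.norm_eq_abs, ← ENNReal.ofReal_rpow_of_nonneg (norm_nonneg _) hq.le, ofReal_norm]
    · have : Continuous fun x => |P.eval x| ^ p.toReal :=
        Continuous.rpow_const (by fun_prop) fun _ => Or.inr hq.le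
      exact (this.integrableOn_Icc (a := 0) (b := 1)).mono_set Set.Ico_subset_Icc_self
    · exact Eventually.of_forall fun x => by positivity
  rw [h3, h4, ← ENNReal.ofReal_mul hK.le, ← ofReal_norm, ENNReal.ofReal_rpow_of_nonneg (norm_nonneg _) hq.le]
  exact ENNReal.ofReal_le_ofReal h2

lemma poly_lower_all (r : ℕ) (p : ℝ≥0∞) (hp : p ≠ 0) :
    ∃ K : NNReal, ∀ P : Polynomial ℝ, P.natDegree < r → 
      ‖P.coeff (r-1)‖ₑ ≤ K * eLpNorm (fun x => P.eval x) p (volume.restrict (Set.Ico 0 1)) := by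
  by_cases hpt : p = ∞
  · obtain ⟨K, hK⟩ := poly_lower_fin r 1 one_ne_zero ENNReal.one_ne_top
    refine ⟨K, fun P hP => (hK P hP).trans ?_⟩
    gcongr
    have : IsProbabilityMeasure (volume.restrict (Set.Ico (0:ℝ) 1)) := ⟨by simp⟩
    exact eLpNorm_le_eLpNorm_of_exponent_le (by simp [hpt]) (by
      exact (Polynomial.continuous P).aestronglyMeasurable)
  · exact poly_lower_fin r p hp hpt

lemma TS_repr {k n : ℕ} {φ : ℝ → ℝ} (h : φ ∈ TS k n) :
    ∃ (F : Finset ℤ) (c : ℤ → ℝ), (∀ z, z ∉ F → c z = 0) ∧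
      φ = fun x => ∑ z ∈ F, c z * tp n ((2:ℝ)^k * x - z/2) := by
  obtain ⟨c, rfl⟩ := Finsupp.mem_span_range_iff_exists_finsupp.1 h
  refine ⟨c.support, c, fun z hz => by simpa using hz, ?_⟩
  ext x
  simp [Finsupp.sum, Finset.sum_apply]

lemma conv_between {r j : ℕ} (hj : j ≤ r) (x h : ℝ) :
    min x (x + r * h) ≤ x + j * h ∧ x + j * h ≤ max x (x + r * h) := by
  have hj' : (j:ℝ) ≤ r := by exact_mod_cast hj
  have hj0 : (0:ℝ) ≤ j := by positivity
  rcases le_total 0 h with h0 | h0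
  · constructor
    · exact (min_le_left _ _).trans (by nlinarith)
    · exact le_trans (by nlinarith) (le_max_right _ _)
  · constructor
    · exact (min_le_right _ _).trans (by nlinarith)
    · exact le_trans (by nlinarith) (le_max_left _ _)

lemma knot_le_iff (k : ℕ) (z : ℤ) (y : ℝ) :
    0 ≤ (2:ℝ)^k * y - z/2 ↔ (z:ℝ) / 2^(k+1) ≤ y := by
  rw [div_le_iff₀ (by positivity), pow_succ]
  constructor <;> intro h <;> linarith

lemma diff_tp_zero_left {r : ℕ} (hr : 0 < r) (k : ℕ) (z : ℤ) (x h : ℝ)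
    (hz : (z:ℝ) / 2^(k+1) ≤ min x (x + r * h)) :
    diff1 r h (fun x => tp (r-1) ((2:ℝ)^k * x - z/2)) x = 0 := by
  rw [← diff_pow_zero r (r-1) (by omega) ((2:ℝ)^k * x - z/2) ((2:ℝ)^k * h)]
  unfold diff1
  refine Finset.sum_congr rfl fun j hj => ?_
  have hj' : j ≤ r := by simp at hj; omega
  have h1 := hz.trans (conv_between hj' x h).1
  rw [← knot_le_iff] at h1
  simp only [tp, h1, if_true]
  ring

lemma diff_tp_zero_right {r : ℕ} (k : ℕ) (z : ℤ) (x h : ℝ)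
    (hz : max x (x + r * h) < (z:ℝ) / 2^(k+1)) :
    diff1 r h (fun x => tp (r-1) ((2:ℝ)^k * x - z/2)) x = 0 := by
  unfold diff1
  refine Finset.sum_eq_zero fun j hj => ?_
  have hj' : j ≤ r := by simp at hj; omega
  have h1 := (conv_between hj' x h).2.trans_lt hz
  have h2 : ¬ (0 ≤ (2:ℝ)^k * (x + j * h) - z/2) := by
    rw [knot_le_iff]; exact not_le.2 h1
  simp only [tp, h2, if_false, mul_zero]

lemma diff_tp_bound {r : ℕ} (k : ℕ) (z : ℤ) (x h : ℝ)
    (hz1 : min x (x + r * h) < (z:ℝ) / 2^(k+1)) (hz2 : (z:ℝ) / 2^(k+1) ≤ max x (x + r * h)) :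
    |x - (z:ℝ) / 2^(k+1)| ≤ r * |h| ∧
    |diff1 r h (fun x => tp (r-1) ((2:ℝ)^k * x - z/2)) x| ≤
      2^r * ((2:ℝ)^k * (r * |h|)) ^ (r-1) := by
  set ξ := (z:ℝ) / 2^(k+1) with hξ
  have hmm : max x (x + r * h) - min x (x + r * h) = r * |h| := by
    rcases le_total 0 h with h0 | h0
    · rw [max_eq_right (by nlinarith [mul_nonneg (Nat.cast_nonneg (α := ℝ) r) h0]),
        min_eq_left (by nlinarith [mul_nonneg (Nat.cast_nonneg (α := ℝ) r) h0]), abs_of_nonneg h0]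
      ring
    · have : (r:ℝ) * h ≤ 0 := mul_nonpos_of_nonneg_of_nonpos (Nat.cast_nonneg _) h0
      rw [max_eq_left (by linarith), min_eq_right (by linarith), abs_of_nonpos h0]
      ring
  have hx1 : min x (x + r*h) ≤ x := min_le_left _ _
  have hx2 : x ≤ max x (x + r*h) := le_max_left _ _
  refine ⟨abs_le.2 ⟨by linarith, by linarith⟩, ?_⟩
  have hsum : ∑ j ∈ Finset.range (r+1), (r.choose j : ℝ) = 2^r := by
    exact_mod_cast Nat.sum_range_choose r
  unfold diff1
  refine (Finset.abs_sum_le_sum_abs _ _).trans ?_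
  rw [← hsum, Finset.sum_mul]
  refine Finset.sum_le_sum fun j hj => ?_
  have hj' : j ≤ r := by simp at hj; omega
  obtain ⟨h1, h2⟩ := conv_between hj' x h
  rw [abs_mul, abs_mul, abs_pow, abs_neg, abs_one, one_pow, one_mul, Nat.abs_cast]
  refine mul_le_mul_of_nonneg_left ?_ (Nat.cast_nonneg _)
  simp only [tp]
  split_ifs with hc
  · rw [abs_of_nonneg (by positivity)]
    gcongr
    have h3 : x + j * h - ξ ≤ r * |h| := by linarith
    have h4 : (2:ℝ)^k * (x + j * h) - z/2 = 2^k * (x + j * h - ξ) := by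
      rw [hξ, pow_succ]; field_simp
    rw [h4]
    gcongr
  · rw [abs_zero]; positivity

lemma diff1_sum {r : ℕ} {k n : ℕ} (F : Finset ℤ) (c : ℤ → ℝ) (h x : ℝ) :
    diff1 r h (fun x => ∑ z ∈ F, c z * tp n ((2:ℝ)^k * x - z/2)) x =
      ∑ z ∈ F, c z * diff1 r h (fun x => tp n ((2:ℝ)^k * x - z/2)) x := by
  unfold diff1
  simp_rw [Finset.mul_sum]
  rw [Finset.sum_comm]
  refine Finset.sum_congr rfl fun z _ => Finset.sum_congr rfl fun j _ => by ring

/-- Domain of the univariate difference. -/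
def Ih (r : ℕ) (h : ℝ) : Set ℝ := {x | x ∈ Set.Icc (0:ℝ) 1 ∧ x + r * h ∈ Set.Icc (0:ℝ) 1}

lemma Ih_measurable (r : ℕ) (h : ℝ) : MeasurableSet (Ih r h) :=
  measurableSet_Icc.inter ((by fun_prop : Measurable fun x : ℝ => x + r * h) measurableSet_Icc)

/-- active knots -/
def actK (r k : ℕ) (h x : ℝ) : Finset ℤ :=
  (Finset.Ico (1:ℤ) (2^(k+1))).filter fun z => |x - (z:ℝ) / 2^(k+1)| ≤ r * |h|

lemma diff1_pointwise {r : ℕ} (hr : 0 < r) {k : ℕ} (F : Finset ℤ) (c : ℤ → ℝ)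
    (hc : ∀ z, z ∉ F → c z = 0) (h x : ℝ) (hx : x ∈ Ih r h) (hx1 : x ≠ 1) (hx2 : x + r * h ≠ 1) :
    |diff1 r h (fun x => ∑ z ∈ F, c z * tp (r-1) ((2:ℝ)^k * x - z/2)) x| ≤
      2^r * ((2:ℝ)^k * (r * |h|)) ^ (r-1) * ∑ z ∈ actK r k h x, |c z| := by
  rw [diff1_sum]
  have hB : 0 ≤ 2^r * ((2:ℝ)^k * (r * |h|)) ^ (r-1) := by positivity
  have hval : ∀ z : ℤ, |c z * diff1 r h (fun x => tp (r-1) ((2:ℝ)^k * x - z/2)) x| ≤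
      if z ∈ actK r k h x then 2^r * ((2:ℝ)^k * (r * |h|)) ^ (r-1) * |c z| else 0 := by
    intro z
    by_cases h1 : (z:ℝ) / 2^(k+1) ≤ min x (x + r * h)
    · rw [diff_tp_zero_left hr k z x h h1, mul_zero, abs_zero]
      split_ifs <;> positivity
    by_cases h2 : max x (x + r * h) < (z:ℝ) / 2^(k+1)
    · rw [diff_tp_zero_right k z x h h2, mul_zero, abs_zero]
      split_ifs <;> positivity
    push Not at h1 h2
    obtain ⟨h3, h4⟩ := diff_tp_bound k z x h h1 h2
    have hz : z ∈ actK r k h x := by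
      simp only [actK, Finset.mem_filter, Finset.mem_Ico]
      refine ⟨⟨?_, ?_⟩, h3⟩
      · have : 0 < (z:ℝ) / 2^(k+1) := lt_of_le_of_lt (le_min hx.1.1 hx.2.1) h1
        have : (0:ℝ) < z := by
          by_contra hcon
          exact absurd this (not_lt.2 (div_nonpos_of_nonpos_of_nonneg (not_lt.1 hcon) (by positivity)))
        have : 0 < z := by exact_mod_cast this
        omega
      · have : (z:ℝ) / 2^(k+1) < 1 := lt_of_le_of_lt h2
          (max_lt (lt_of_le_of_ne hx.1.2 hx1) (lt_of_le_of_ne hx.2.2 hx2))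
        rw [div_lt_one (by positivity)] at this
        exact_mod_cast this
    rw [if_pos hz, abs_mul, mul_comm]
    gcongr
  calc _ ≤ ∑ z ∈ F, |c z * diff1 r h (fun x => tp (r-1) ((2:ℝ)^k * x - z/2)) x| :=
        Finset.abs_sum_le_sum_abs _ _
    _ ≤ ∑ z ∈ F, if z ∈ actK r k h x then 2^r * ((2:ℝ)^k * (r * |h|)) ^ (r-1) * |c z| else 0 :=
        Finset.sum_le_sum fun z _ => hval z
    _ = ∑ z ∈ F ∩ actK r k h x, 2^r * ((2:ℝ)^k * (r * |h|)) ^ (r-1) * |c z| := by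
        rw [Finset.sum_ite_mem]
    _ ≤ ∑ z ∈ actK r k h x, 2^r * ((2:ℝ)^k * (r * |h|)) ^ (r-1) * |c z| :=
        Finset.sum_le_sum_of_subset_of_nonneg Finset.inter_subset_right
          fun z _ _ => by positivity
    _ = _ := by rw [Finset.mul_sum]

lemma actK_card (r k m : ℕ) (hkm : k < m) (h x : ℝ) (hh : |h| ≤ ((2:ℝ)^m)⁻¹) :
    (actK r k h x).card ≤ 2 * r + 1 := by
  have hsub : actK r k h x ⊆ Finset.Icc ⌈(2:ℝ)^(k+1) * x - r⌉ ⌊(2:ℝ)^(k+1) * x + r⌋ := by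
    intro z hz
    simp only [actK, Finset.mem_filter, Finset.mem_Ico] at hz
    obtain ⟨_, hz⟩ := hz
    have hN : (0:ℝ) < 2^(k+1) := by positivity
    have h1 : (2:ℝ)^(k+1) * |h| ≤ 1 := by
      calc (2:ℝ)^(k+1) * |h| ≤ 2^m * ((2:ℝ)^m)⁻¹ := by
            gcongr
            · norm_num
            · omega
        _ = 1 := by field_simp
    have h2 : |(2:ℝ)^(k+1) * x - z| ≤ r := by
      have : (2:ℝ)^(k+1) * x - z = 2^(k+1) * (x - z/2^(k+1)) := by field_simp
      rw [this, abs_mul, abs_of_pos hN]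
      calc _ ≤ (2:ℝ)^(k+1) * (r * |h|) := by gcongr
        _ = r * (2^(k+1) * |h|) := by ring
        _ ≤ r * 1 := by gcongr
        _ = r := mul_one _
    rw [abs_le] at h2
    rw [Finset.mem_Icc, Int.ceil_le, Int.le_floor]
    constructor <;> linarith
  refine (Finset.card_le_card hsub).trans ?_
  rw [Int.card_Icc]
  have h1 := Int.floor_le ((2:ℝ)^(k+1) * x + r)
  have h2 := Int.le_ceil ((2:ℝ)^(k+1) * x - r)
  have : ((⌊(2:ℝ)^(k+1) * x + r⌋ : ℤ) : ℝ) ≤ ((⌈(2:ℝ)^(k+1) * x - r⌉ + 2 * r : ℤ) : ℝ) := by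
    push_cast; linarith
  have : ⌊(2:ℝ)^(k+1) * x + r⌋ ≤ ⌈(2:ℝ)^(k+1) * x - r⌉ + 2 * r := by exact_mod_cast this
  omega

/-- The leading coefficient on a cell. -/
def Lc (F : Finset ℤ) (c : ℤ → ℝ) (m : ℤ) : ℝ := ∑ z ∈ F.filter (· ≤ m), c z

lemma Lc_sub (F : Finset ℤ) (c : ℤ → ℝ) (hc : ∀ z, z ∉ F → c z = 0) (m : ℤ) :
    c m = Lc F c m - Lc F c (m-1) := by
  unfold Lc
  by_cases hm : m ∈ F
  · have : F.filter (· ≤ m) = insert m (F.filter (· ≤ m-1)) := by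
      ext z; simp only [Finset.mem_filter, Finset.mem_insert]
      constructor
      · rintro ⟨h1, h2⟩
        rcases eq_or_lt_of_le h2 with h | h
        · exact Or.inl h
        · exact Or.inr ⟨h1, by omega⟩
      · rintro (h | h)
        · subst h; exact ⟨hm, le_rfl⟩
        · exact ⟨h.1, by omega⟩
    rw [this, Finset.sum_insert (by simp)]
    ring
  · have : F.filter (· ≤ m) = F.filter (· ≤ m-1) := by
      ext z; simp only [Finset.mem_filter]
      constructor
      · rintro ⟨h1, h2⟩
        refine ⟨h1, ?_⟩
        have : z ≠ m := by rintro rfl; exact hm h1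
        omega
      · rintro h
        exact ⟨h.1, by omega⟩
    rw [this, hc m hm]; ring

lemma Lc_bound (r : ℕ) (hr : 0 < r) (p : ℝ≥0∞) (hp : p ≠ 0) :
    ∃ K : NNReal, ∀ (k : ℕ) (F : Finset ℤ) (c : ℤ → ℝ) (m : ℤ),
      ‖Lc F c m‖ₑ ≤ K * eLpNorm (fun u : ℝ => ∑ z ∈ F, c z *
        tp (r-1) ((2:ℝ)^k * ((m + u) / 2^(k+1)) - z/2)) p (volume.restrict (Set.Ico 0 1)) := by
  obtain ⟨K, hK⟩ := poly_lower_all r p hp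
  refine ⟨2^(r-1) * K, fun k F c m => ?_⟩
  set P : Polynomial ℝ := ∑ z ∈ F.filter (· ≤ m), Polynomial.C (c z) *
    (Polynomial.C (((m:ℝ) - z)/2) + Polynomial.C (1/2) * Polynomial.X) ^ (r-1) with hP
  have hlin : ∀ a : ℝ, (Polynomial.C a + Polynomial.C (1/2:ℝ) * Polynomial.X).natDegree ≤ 1 := by
    intro a; compute_degree
  have hdeg : P.natDegree < r := by
    refine lt_of_le_of_lt (b := r - 1) ?_ (by omega)
    refine Polynomial.natDegree_sum_le_of_forall_le _ _ fun z _ => ?_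
    refine (Polynomial.natDegree_C_mul_le _ _).trans ?_
    refine (Polynomial.natDegree_pow_le).trans ?_
    calc _ ≤ (r-1) * 1 := by gcongr; exact hlin _
      _ = r - 1 := mul_one _
  have hcoef : P.coeff (r-1) = (1/2)^(r-1) * Lc F c m := by
    rw [hP, Polynomial.finsetSum_coeff, Lc, Finset.mul_sum]
    refine Finset.sum_congr rfl fun z _ => ?_
    rw [Polynomial.coeff_C_mul]
    have := Polynomial.coeff_pow_of_natDegree_le (m := r-1) (hlin (((m:ℝ) - z)/2))
    rw [mul_one] at this
    rw [this]
    rw [mul_comm]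
    congr 2
    simp [Polynomial.coeff_C]
  have h1 := hK P hdeg
  have h2 : ‖Lc F c m‖ₑ = 2^(r-1) * ‖P.coeff (r-1)‖ₑ := by
    have : Lc F c m = 2^(r-1) * P.coeff (r-1) := by
      rw [hcoef, ← mul_assoc, ← mul_pow]; norm_num
    rw [this, enorm_mul, enorm_pow]
    congr 2
    rw [Real.enorm_eq_ofReal (by norm_num)]; norm_num
  rw [h2]
  push_cast
  rw [mul_assoc]
  gcongr
  refine h1.trans (le_of_eq ?_)
  congr 1
  refine eLpNorm_congr_ae ?_
  filter_upwards [ae_restrict_mem measurableSet_Ico] with u hu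
  rw [hP, Polynomial.eval_finsetSum, Finset.sum_filter]
  refine Finset.sum_congr rfl fun z _ => ?_
  have he : (2:ℝ)^k * ((m + u) / 2^(k+1)) - z/2 = ((m:ℝ) - z)/2 + 1/2 * u := by
    rw [pow_succ]; field_simp; ring
  rw [he]
  unfold tp
  split_ifs with hz h3 h3
  · simp
  · exfalso
    apply h3
    have : (z:ℝ) ≤ m := by exact_mod_cast hz
    have := hu.1
    linarith
  · exfalso
    have hz' : m + 1 ≤ z := by omega
    have : (m:ℝ) + 1 ≤ z := by exact_mod_cast hz'
    have := hu.2
    linarith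
  · simp

lemma map_affine (k : ℕ) (z : ℤ) :
    Measure.map (fun u : ℝ => ((z:ℝ) + u) / 2^(k+1)) volume =
      ENNReal.ofReal (2^(k+1)) • (volume : Measure ℝ) := by
  have h1 : (fun u : ℝ => ((z:ℝ) + u) / 2^(k+1)) = (fun x => ((2:ℝ)^(k+1))⁻¹ * x) ∘ (fun u => (z:ℝ) + u) := by
    ext u; simp [div_eq_inv_mul]
  rw [h1, ← Measure.map_map (by fun_prop) (by fun_prop), map_add_left_eq_self,
    Real.map_volume_mul_left (by positivity), inv_inv, abs_of_pos (by positivity)]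

/-- cell -/
def cell (k : ℕ) (z : ℤ) : Set ℝ := Set.Ico ((z:ℝ)/2^(k+1)) (((z:ℝ)+1)/2^(k+1))

lemma cell_scale (k : ℕ) (z : ℤ) (p : ℝ≥0∞) (φ : ℝ → ℝ) (hφ : Measurable φ) :
    eLpNorm (fun u : ℝ => φ (((z:ℝ) + u) / 2^(k+1))) p (volume.restrict (Set.Ico 0 1)) =
      ENNReal.ofReal (2^(k+1)) ^ p⁻¹.toReal * eLpNorm φ p (volume.restrict (cell k z)) := by
  have hT : Measurable (fun u : ℝ => ((z:ℝ) + u) / 2^(k+1)) := by fun_prop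
  have hpre : (fun u : ℝ => ((z:ℝ) + u) / 2^(k+1)) ⁻¹' (cell k z) = Set.Ico 0 1 := by
    ext u
    simp only [cell, Set.mem_preimage, Set.mem_Ico]
    rw [div_le_div_iff_of_pos_right (by positivity), div_lt_div_iff_of_pos_right (by positivity)]
    constructor <;> rintro ⟨h1, h2⟩ <;> constructor <;> linarith
  have h2 := Measure.restrict_map hT (μ := volume) (s := cell k z) measurableSet_Ico
  rw [hpre, map_affine, Measure.restrict_smul] at h2
  have h3 := eLpNorm_map_measure (p := p) (μ := volume.restrict (Set.Ico (0:ℝ) 1)) (g := φ)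
    hφ.aestronglyMeasurable hT.aemeasurable
  rw [← h2, eLpNorm_smul_measure_of_ne_zero (by simp)] at h3
  rw [show (fun u : ℝ => φ (((z:ℝ) + u) / 2^(k+1))) = φ ∘ (fun u : ℝ => ((z:ℝ) + u) / 2^(k+1)) from rfl,
    ← h3]
  simp

lemma cell_subset {k : ℕ} {z : ℤ} (h0 : 0 ≤ z) (h1 : z < 2^(k+1)) : cell k z ⊆ Set.Icc 0 1 := by
  intro x hx
  have h0' : (0:ℝ) ≤ z := by exact_mod_cast h0
  have h1' : (z:ℝ) + 1 ≤ 2^(k+1) := by exact_mod_cast h1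
  refine ⟨le_trans (by positivity) hx.1, hx.2.le.trans ?_⟩
  rw [div_le_one (by positivity)]; exact h1'

lemma cell_disjoint (k : ℕ) : Pairwise (Function.onFun Disjoint (cell k)) := by
  intro a b hab
  rw [Function.onFun, Set.disjoint_left]
  intro x h1 h2
  simp only [cell, Set.mem_Ico] at h1 h2
  rw [div_le_iff₀ (by positivity), lt_div_iff₀ (by positivity)] at h1 h2
  apply hab
  have e1 : (a:ℝ) < b + 1 := by linarith
  have e2 : (b:ℝ) < a + 1 := by linarith
  have e1 : a < b + 1 := by exact_mod_cast e1
  have e2 : b < a + 1 := by exact_mod_cast e2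
  omega

lemma sum_cells (k : ℕ) (S : Finset ℤ) (hS : ∀ z ∈ S, 0 ≤ z ∧ z < 2^(k+1)) (f : ℝ → ℝ≥0∞) :
    ∑ z ∈ S, ∫⁻ x in cell k z, f x ≤ ∫⁻ x in Set.Icc 0 1, f x := by
  rw [← lintegral_biUnion_finset (fun a _ b _ hab => cell_disjoint k hab)
    (fun z _ => measurableSet_Ico)]
  refine lintegral_mono_set ?_
  simp only [Set.iUnion_subset_iff]
  exact fun z hz => cell_subset (hS z hz).1 (hS z hz).2

lemma sum_rpow_le {ι : Type*} (S : Finset ι) (n : ℕ) (hn : S.card ≤ n) (a : ι → ℝ≥0∞) {q : ℝ}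
    (hq : 0 < q) : (∑ z ∈ S, a z) ^ q ≤ (n:ℝ≥0∞) ^ q * ∑ z ∈ S, a z ^ q := by
  rcases S.eq_empty_or_nonempty with rfl | hne
  · simp [hq]
  obtain ⟨z0, hz0, hmax⟩ := S.exists_max_image a hne
  calc (∑ z ∈ S, a z) ^ q ≤ (n * a z0) ^ q := by
        gcongr
        calc _ ≤ S.card • a z0 := Finset.sum_le_card_nsmul _ _ _ hmax
          _ ≤ n * a z0 := by rw [nsmul_eq_mul]; gcongr
    _ = (n:ℝ≥0∞) ^ q * a z0 ^ q := ENNReal.mul_rpow_of_nonneg _ _ hq.le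
    _ ≤ _ := by
        gcongr
        exact Finset.single_le_sum (f := fun z => a z ^ q) (fun _ _ => bot_le) hz0

lemma ae_Ih (r : ℕ) (h : ℝ) : ∀ᵐ x : ℝ ∂(volume.restrict (Ih r h)),
    x ∈ Ih r h ∧ x ≠ 1 ∧ x + r * h ≠ 1 := by
  have h1 : ∀ᵐ x : ℝ ∂(volume.restrict (Ih r h)), x ≠ 1 :=
    ae_restrict_of_ae (Measure.ae_ne volume 1)
  have h2 : ∀ᵐ x : ℝ ∂(volume.restrict (Ih r h)), x ≠ 1 - r * h :=
    ae_restrict_of_ae (Measure.ae_ne volume _)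
  filter_upwards [ae_restrict_mem (Ih_measurable r h), h1, h2] with x a b c
  exact ⟨a, b, fun hh => c (by linarith)⟩

lemma U_small_aux (r : ℕ) (hr : 0 < r) (p : ℝ≥0∞) (hp : p ≠ 0) :
    ∃ K : NNReal, ∀ (k m : ℕ) (h : ℝ), k < m → |h| ≤ ((2:ℝ)^m)⁻¹ → ∀ φ ∈ TS k (r-1),
      eLpNorm (diff1 r h φ) p (volume.restrict (Ih r h)) ≤
        ENNReal.ofReal (2^r * ((2:ℝ)^k * (r * |h|)) ^ (r-1)) * K *
          (ENNReal.ofReal (2 * r * |h|) * ENNReal.ofReal (2^(k+1))) ^ p⁻¹.toReal *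
          eLpNorm φ p (volume.restrict (Set.Icc 0 1)) := by
  obtain ⟨K, hK⟩ := Lc_bound r hr p hp
  have hL : ∀ (k : ℕ) (F : Finset ℤ) (c : ℤ → ℝ) (φ : ℝ → ℝ), Measurable φ →
      φ = (fun x => ∑ z ∈ F, c z * tp (r-1) ((2:ℝ)^k * x - z/2)) → ∀ z : ℤ,
      ‖Lc F c z‖ₑ ≤ K * (ENNReal.ofReal (2^(k+1)) ^ p⁻¹.toReal *
        eLpNorm φ p (volume.restrict (cell k z))) := by
    intro k F c φ hm hφ z
    rw [← cell_scale k z p φ hm, hφ]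
    exact hK k F c z
  by_cases hpt : p = ∞
  · subst hpt
    refine ⟨(2 * r + 1) * (2 * K), fun k m h hkm hh φ hφ => ?_⟩
    obtain ⟨F, c, hc, hrep⟩ := TS_repr hφ
    have hm := TS_measurable hφ
    have hL' := hL k F c φ hm hrep
    set Φ := eLpNorm φ ∞ (volume.restrict (Set.Icc 0 1)) with hΦ
    have hLz : ∀ z : ℤ, 0 ≤ z → z < 2^(k+1) → ‖Lc F c z‖ₑ ≤ K * Φ := by
      intro z h0 h1
      refine (hL' z).trans ?_
      simp only [ENNReal.inv_top, ENNReal.toReal_zero, ENNReal.rpow_zero, one_mul]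
      gcongr
      exact eLpNorm_mono_measure _ (Measure.restrict_mono (cell_subset h0 h1) le_rfl)
    have hcz : ∀ z ∈ Finset.Ico (1:ℤ) (2^(k+1)), ‖c z‖ₑ ≤ 2 * K * Φ := by
      intro z hz
      rw [Finset.mem_Ico] at hz
      rw [Lc_sub F c hc z]
      refine (enorm_sub_le).trans ?_
      calc _ ≤ K * Φ + K * Φ := add_le_add (hLz z (by omega) hz.2) (hLz (z-1) (by omega) (by omega))
        _ = _ := by ring
    simp only [ENNReal.inv_top, ENNReal.toReal_zero, ENNReal.rpow_zero, mul_one]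
    rw [eLpNorm_exponent_top]
    refine eLpNormEssSup_le_of_ae_enorm_bound ?_
    filter_upwards [ae_Ih r h] with x ⟨hx, hx1, hx2⟩
    have hpt := diff1_pointwise hr (k := k) F c hc h x hx hx1 hx2
    rw [← hrep] at hpt
    rw [Real.enorm_eq_ofReal_abs]
    refine (ENNReal.ofReal_le_ofReal hpt).trans ?_
    rw [ENNReal.ofReal_mul (by positivity), mul_assoc]
    gcongr
    rw [ENNReal.ofReal_sum_of_nonneg (fun _ _ => abs_nonneg _)]
    calc _ ≤ ∑ z ∈ actK r k h x, 2 * K * Φ := by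
          refine Finset.sum_le_sum fun z hz => ?_
          rw [← Real.enorm_eq_ofReal_abs]
          exact hcz z (Finset.mem_filter.1 hz).1
      _ = (actK r k h x).card * (2 * K * Φ) := by rw [Finset.sum_const, nsmul_eq_mul]
      _ ≤ ((2 * r + 1 : ℕ) : ℝ≥0∞) * (2 * K * Φ) := by
          gcongr; exact actK_card r k m hkm h x hh
      _ = _ := by push_cast; ring
  · set q := p.toReal with hq
    have hq0 : 0 < q := ENNReal.toReal_pos hp hpt
    have hpq : p⁻¹.toReal = 1/q := by rw [ENNReal.toReal_inv, one_div]
    refine ⟨(2 * r + 1) * (2 * K) * 2 ^ (1/q), fun k m h hkm hh φ hφ => ?_⟩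
    obtain ⟨F, c, hc, hrep⟩ := TS_repr hφ
    have hm := TS_measurable hφ
    have hL' := hL k F c φ hm hrep
    rw [hpq] at hL' ⊢
    set N := ENNReal.ofReal (2^(k+1)) with hN
    set A := ∫⁻ x in Set.Icc (0:ℝ) 1, ‖φ x‖ₑ ^ q with hA
    have heL : ∀ (f : ℝ → ℝ) (s : Set ℝ), eLpNorm f p (volume.restrict s) =
        (∫⁻ x in s, ‖f x‖ₑ ^ q) ^ (1/q) := fun f s => by
      rw [eLpNorm_eq_lintegral_rpow_enorm_toReal hp hpt]
    have hLz : ∀ z : ℤ, ‖Lc F c z‖ₑ ^ q ≤ (K:ℝ≥0∞) ^ q * (N * ∫⁻ x in cell k z, ‖φ x‖ₑ ^ q) := by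
      intro z
      calc _ ≤ (K * (N ^ (1/q) * eLpNorm φ p (volume.restrict (cell k z)))) ^ q := by
            gcongr; exact hL' z
        _ = _ := by
          rw [heL, ENNReal.mul_rpow_of_nonneg _ _ hq0.le, ENNReal.mul_rpow_of_nonneg _ _ hq0.le,
            ← ENNReal.rpow_mul, ← ENNReal.rpow_mul, one_div_mul_cancel hq0.ne', ENNReal.rpow_one,
            ENNReal.rpow_one]
    have hcz : ∀ z : ℤ, ‖c z‖ₑ ^ q ≤ 2^q * (‖Lc F c z‖ₑ ^ q + ‖Lc F c (z-1)‖ₑ ^ q) := by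
      intro z
      have h1 : ‖c z‖ₑ ≤ ‖Lc F c z‖ₑ + ‖Lc F c (z-1)‖ₑ := by
        conv_lhs => rw [Lc_sub F c hc z]
        exact enorm_sub_le
      have h2 := sum_rpow_le (Finset.univ : Finset (Fin 2)) 2 (by simp)
        ![‖Lc F c z‖ₑ, ‖Lc F c (z-1)‖ₑ] hq0
      simp only [Fin.sum_univ_two, Matrix.cons_val_zero, Matrix.cons_val_one, Nat.cast_ofNat] at h2
      exact le_trans (by gcongr) h2
    set B := ENNReal.ofReal (2^r * ((2:ℝ)^k * (r * |h|)) ^ (r-1)) with hB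
    set S := Finset.Ico (1:ℤ) (2^(k+1)) with hS
    have hsumc : ∑ z ∈ S, ‖c z‖ₑ ^ q ≤ 2^q * ((K:ℝ≥0∞)^q * N * (2 * A)) := by
      calc _ ≤ ∑ z ∈ S, 2^q * (‖Lc F c z‖ₑ ^ q + ‖Lc F c (z-1)‖ₑ ^ q) :=
            Finset.sum_le_sum fun z _ => hcz z
        _ = 2^q * (∑ z ∈ S, ‖Lc F c z‖ₑ ^ q + ∑ z ∈ S, ‖Lc F c (z-1)‖ₑ ^ q) := by
            rw [← Finset.mul_sum, Finset.sum_add_distrib]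
        _ ≤ 2^q * ((K:ℝ≥0∞)^q * N * A + (K:ℝ≥0∞)^q * N * A) := by
            gcongr
            · calc _ ≤ ∑ z ∈ S, (K:ℝ≥0∞) ^ q * (N * ∫⁻ x in cell k z, ‖φ x‖ₑ ^ q) :=
                    Finset.sum_le_sum fun z _ => hLz z
                _ = (K:ℝ≥0∞)^q * N * ∑ z ∈ S, ∫⁻ x in cell k z, ‖φ x‖ₑ ^ q := by
                    rw [Finset.mul_sum]; simp_rw [mul_assoc]
                _ ≤ _ := by
                    gcongr
                    refine sum_cells k S (fun z hz => ?_) _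
                    rw [hS, Finset.mem_Ico] at hz
                    exact ⟨by omega, hz.2⟩
            · calc _ ≤ ∑ z ∈ S, (K:ℝ≥0∞) ^ q * (N * ∫⁻ x in cell k (z-1), ‖φ x‖ₑ ^ q) :=
                    Finset.sum_le_sum fun z _ => hLz (z-1)
                _ = (K:ℝ≥0∞)^q * N * ∑ z ∈ S, ∫⁻ x in cell k (z-1), ‖φ x‖ₑ ^ q := by
                    rw [Finset.mul_sum]; simp_rw [mul_assoc]
                _ = (K:ℝ≥0∞)^q * N * ∑ z ∈ S.image (fun z => z - 1),
                      ∫⁻ x in cell k z, ‖φ x‖ₑ ^ q := by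
                    rw [Finset.sum_image (fun a _ b _ hab => by simpa using hab)]
                _ ≤ _ := by
                    gcongr
                    refine sum_cells k _ (fun z hz => ?_) _
                    simp only [hS, Finset.mem_image, Finset.mem_Ico] at hz
                    obtain ⟨y, hy, rfl⟩ := hz
                    exact ⟨by omega, by omega⟩
        _ = _ := by ring
    have hIntg : ∫⁻ x in Ih r h, ‖diff1 r h φ x‖ₑ ^ q ≤
        B ^ q * ((2 * r + 1 : ℕ) : ℝ≥0∞) ^ q *
          (ENNReal.ofReal (2 * r * |h|) * (2^q * ((K:ℝ≥0∞)^q * N * (2 * A)))) := by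
      have hJ : ∀ z : ℤ, MeasurableSet {x : ℝ | |x - (z:ℝ) / 2^(k+1)| ≤ r * |h|} := fun z =>
        measurableSet_le (by fun_prop) (by fun_prop)
      calc _ ≤ ∫⁻ x in Ih r h, B ^ q * ((2 * r + 1 : ℕ) : ℝ≥0∞) ^ q *
            ∑ z ∈ S, Set.indicator {x : ℝ | |x - (z:ℝ) / 2^(k+1)| ≤ r * |h|}
              (fun _ => ‖c z‖ₑ ^ q) x := by
            refine lintegral_mono_ae ?_
            filter_upwards [ae_Ih r h] with x ⟨hx, hx1, hx2⟩
            have hpt := diff1_pointwise hr (k := k) F c hc h x hx hx1 hx2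
            rw [← hrep] at hpt
            have h1 : ‖diff1 r h φ x‖ₑ ≤ B * ∑ z ∈ actK r k h x, ‖c z‖ₑ := by
              rw [Real.enorm_eq_ofReal_abs]
              refine (ENNReal.ofReal_le_ofReal hpt).trans ?_
              rw [ENNReal.ofReal_mul (by positivity),
                ENNReal.ofReal_sum_of_nonneg (fun _ _ => abs_nonneg _)]
              simp_rw [Real.enorm_eq_ofReal_abs]
              exact le_rfl
            calc _ ≤ (B * ∑ z ∈ actK r k h x, ‖c z‖ₑ) ^ q := by gcongr
              _ = B ^ q * (∑ z ∈ actK r k h x, ‖c z‖ₑ) ^ q := ENNReal.mul_rpow_of_nonneg _ _ hq0.le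
              _ ≤ B ^ q * (((2 * r + 1 : ℕ) : ℝ≥0∞) ^ q * ∑ z ∈ actK r k h x, ‖c z‖ₑ ^ q) := by
                  gcongr
                  exact sum_rpow_le _ _ (actK_card r k m hkm h x hh) _ hq0
              _ = _ := by
                  rw [mul_assoc]
                  congr 2
                  rw [actK, Finset.sum_filter]
                  refine Finset.sum_congr rfl fun z _ => ?_
                  simp only [Set.indicator_apply, Set.mem_ofPred_eq]
        _ ≤ ∫⁻ x, B ^ q * ((2 * r + 1 : ℕ) : ℝ≥0∞) ^ q *
            ∑ z ∈ S, Set.indicator {x : ℝ | |x - (z:ℝ) / 2^(k+1)| ≤ r * |h|}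
              (fun _ => ‖c z‖ₑ ^ q) x := setLIntegral_le_lintegral _ _
        _ = B ^ q * ((2 * r + 1 : ℕ) : ℝ≥0∞) ^ q *
            ∑ z ∈ S, ENNReal.ofReal (2 * r * |h|) * ‖c z‖ₑ ^ q := by
            rw [lintegral_const_mul _ (Finset.measurable_sum _ fun z _ =>
                measurable_const.indicator (hJ z)),
              lintegral_finsetSum _ (fun z _ => measurable_const.indicator (hJ z))]
            congr 1
            refine Finset.sum_congr rfl fun z _ => ?_
            rw [lintegral_indicator_const (hJ z), mul_comm]
            congr 1
            have : {x : ℝ | |x - (z:ℝ) / 2^(k+1)| ≤ r * |h|} =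
                Metric.closedBall ((z:ℝ) / 2^(k+1)) (r * |h|) := by
              ext x; simp [Metric.mem_closedBall, Real.dist_eq]
            rw [this, Real.volume_closedBall]
            congr 1; ring
        _ ≤ _ := by
            rw [← Finset.mul_sum]
            gcongr
    rw [heL, heL, ← hA]
    calc _ ≤ (B ^ q * ((2 * r + 1 : ℕ) : ℝ≥0∞) ^ q *
          (ENNReal.ofReal (2 * r * |h|) * (2^q * ((K:ℝ≥0∞)^q * N * (2 * A))))) ^ (1/q) := by
          gcongr
      _ = ((B * ((2 * r + 1 : ℕ) : ℝ≥0∞) * (2 * K)) ^ q * (2 * (ENNReal.ofReal (2 * r * |h|) * N) * A))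
            ^ (1/q) := by
          congr 1
          rw [ENNReal.mul_rpow_of_nonneg _ _ hq0.le, ENNReal.mul_rpow_of_nonneg _ _ hq0.le,
            ENNReal.mul_rpow_of_nonneg _ _ hq0.le]
          ring
      _ = _ := by
          have hq1 : 0 ≤ 1/q := by positivity
          rw [ENNReal.mul_rpow_of_nonneg _ _ hq1, ← ENNReal.rpow_mul, mul_one_div_cancel hq0.ne',
            ENNReal.rpow_one, ENNReal.mul_rpow_of_nonneg _ _ hq1, ENNReal.mul_rpow_of_nonneg 2 _ hq1]
          push_cast
          rw [ENNReal.coe_rpow_of_nonneg _ hq1]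
          push_cast
          ring

lemma U_small (r : ℕ) (hr : 0 < r) (p : ℝ≥0∞) (hp : p ≠ 0) :
    ∃ K : NNReal, ∀ (k m : ℕ) (h : ℝ), k < m → |h| ≤ ((2:ℝ)^m)⁻¹ → ∀ φ ∈ TS k (r-1),
      eLpNorm (diff1 r h φ) p (volume.restrict (Ih r h)) ≤
        K * ENNReal.ofReal ((2:ℝ)^(((r:ℝ) - 1 + p⁻¹.toReal) * ((k:ℝ) - m))) *
          eLpNorm φ p (volume.restrict (Set.Icc 0 1)) := by
  obtain ⟨K, hK⟩ := U_small_aux r hr p hp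
  set ip := p⁻¹.toReal with hip
  have hip0 : 0 ≤ ip := ENNReal.toReal_nonneg
  refine ⟨(2^r * r^(r-1)) * K * (4 * r)^ip, fun k m h hkm hh φ hφ => (hK k m h hkm hh φ hφ).trans ?_⟩
  refine mul_le_mul_left ?_ _
  set E : ℝ := (2:ℝ)^((k:ℝ) - m) with hE
  have hEp : 0 < E := by positivity
  have hkh : (2:ℝ)^k * |h| ≤ E := by
    rw [hE, Real.rpow_sub (by norm_num), Real.rpow_natCast, Real.rpow_natCast, div_eq_mul_inv]
    gcongr
  have hpow : (2:ℝ)^(((r:ℝ) - 1 + ip) * ((k:ℝ) - m)) = E^(r-1) * E^ip := by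
    rw [mul_comm, Real.rpow_mul (by norm_num), Real.rpow_add hEp, ← Real.rpow_natCast E (r-1),
      Nat.cast_sub hr, Nat.cast_one]
  rw [hpow, ENNReal.ofReal_mul (p := E^(r-1)) (by positivity)]
  have h1 : ENNReal.ofReal (2^r * ((2:ℝ)^k * (r * |h|)) ^ (r-1)) ≤
      (2^r * r^(r-1)) * ENNReal.ofReal (E^(r-1)) := by
    have : 2^r * ((2:ℝ)^k * (r * |h|)) ^ (r-1) ≤ (2^r * r^(r-1)) * E^(r-1) := by
      rw [mul_assoc, ← mul_pow]
      refine mul_le_mul_of_nonneg_left (pow_le_pow_left₀ (by positivity) ?_ _) (by positivity)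
      calc (2:ℝ)^k * (r * |h|) = r * (2^k * |h|) := by ring
        _ ≤ r * E := by gcongr
    refine (ENNReal.ofReal_le_ofReal this).trans (le_of_eq ?_)
    rw [ENNReal.ofReal_mul (by positivity), ENNReal.ofReal_mul (by positivity),
      ENNReal.ofReal_pow (by positivity), ENNReal.ofReal_pow (by positivity)]
    simp
  have h2 : (ENNReal.ofReal (2 * r * |h|) * ENNReal.ofReal (2^(k+1))) ^ ip ≤
      (4 * r)^ip * ENNReal.ofReal (E^ip) := by
    rw [← ENNReal.ofReal_rpow_of_pos hEp, ← ENNReal.mul_rpow_of_nonneg _ _ hip0,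
      ← ENNReal.ofReal_mul (by positivity)]
    gcongr
    calc _ ≤ ENNReal.ofReal ((4 * r) * E) := by
          apply ENNReal.ofReal_le_ofReal
          calc 2 * r * |h| * 2^(k+1) = (4 * r) * (2^k * |h|) := by ring
            _ ≤ _ := by gcongr
      _ = _ := by rw [ENNReal.ofReal_mul (by positivity), ENNReal.ofReal_mul (by positivity)]; simp
  calc _ ≤ (2^r * r^(r-1)) * ENNReal.ofReal (E^(r-1)) * K * ((4 * r)^ip * ENNReal.ofReal (E^ip)) :=
        mul_le_mul' (mul_le_mul' h1 le_rfl) h2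
    _ = _ := by
        push_cast
        rw [ENNReal.coe_rpow_of_nonneg _ hip0]
        push_cast
        ring

/-- a small exponent for quasi-triangle inequality -/
lemma exists_tau (p θ : ℝ≥0∞) (hp : p ≠ 0) (hθ : θ ≠ 0) : ∃ τ : ℝ, 0 < τ ∧ τ ≤ 1 ∧
    ENNReal.ofReal τ ≤ p ∧ ENNReal.ofReal τ ≤ θ := by
  refine ⟨(min 1 (min p θ)).toReal, ?_, ?_, ?_, ?_⟩
  · apply ENNReal.toReal_pos
    · simp [hp, hθ, min_eq_iff]
    · exact ne_top_of_le_ne_top ENNReal.one_ne_top (min_le_left _ _)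
  · exact ENNReal.toReal_mono ENNReal.one_ne_top (min_le_left _ _)
  · exact ENNReal.ofReal_toReal_le.trans ((min_le_right _ _).trans (min_le_left _ _))
  · exact ENNReal.ofReal_toReal_le.trans ((min_le_right _ _).trans (min_le_right _ _))

lemma U_trivial (r : ℕ) (p : ℝ≥0∞) (hp : p ≠ 0) :
    ∃ K : NNReal, ∀ (h : ℝ) (φ : ℝ → ℝ), Measurable φ →
      eLpNorm (diff1 r h φ) p (volume.restrict (Ih r h)) ≤
        K * eLpNorm φ p (volume.restrict (Set.Icc 0 1)) := by
  obtain ⟨τ, h0, h1, h2, -⟩ := exists_tau p p hp hp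
  refine ⟨(∑ j ∈ Finset.range (r+1), (‖(-1 : ℝ) ^ (r - j) * (r.choose j : ℝ)‖₊) ^ τ) ^ (1/τ),
    fun h φ hφ => ?_⟩
  have hτ' : 0 ≤ 1/τ := by positivity
  have key := eLpNorm_sum_rpow_le h0 h1 h2 (Finset.range (r+1))
    (fun j x => (-1 : ℝ) ^ (r - j) * (r.choose j : ℝ) * φ (x + j * h))
    (ν := volume.restrict (Ih r h))
    (fun j => by
      have : Measurable fun x : ℝ => (-1 : ℝ) ^ (r - j) * (r.choose j : ℝ) * φ (x + j * h) := by
        fun_prop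
      exact this.aestronglyMeasurable)
  have hterm : ∀ j ∈ Finset.range (r+1), eLpNorm (fun x => (-1 : ℝ) ^ (r - j) * (r.choose j : ℝ) *
      φ (x + j * h)) p (volume.restrict (Ih r h)) ≤ ‖(-1 : ℝ) ^ (r - j) * (r.choose j : ℝ)‖ₑ *
        eLpNorm φ p (volume.restrict (Set.Icc 0 1)) := by
    intro j hj
    have hj' : j ≤ r := by simp at hj; omega
    rw [show (fun x => (-1 : ℝ) ^ (r - j) * (r.choose j : ℝ) * φ (x + j * h)) =
      ((-1 : ℝ) ^ (r - j) * (r.choose j : ℝ)) • (fun x => φ (x + j * h)) from rfl]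
    rw [eLpNorm_const_smul]
    gcongr
    calc eLpNorm (fun x => φ (x + j * h)) p (volume.restrict (Ih r h))
        ≤ eLpNorm (fun x => φ (x + j * h)) p
          (volume.restrict ((fun x => x + j * h) ⁻¹' (Set.Icc 0 1))) := by
          refine eLpNorm_mono_measure _ (Measure.restrict_mono (fun x hx => ?_) le_rfl)
          obtain ⟨e1, e2⟩ := conv_between hj' x h
          exact ⟨(le_min hx.1.1 hx.2.1).trans e1, e2.trans (max_le hx.1.2 hx.2.2)⟩
      _ = _ := by
          have hmp := (measurePreserving_add_right volume ((j:ℝ) * h)).restrict_preimage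
            (s := Set.Icc (0:ℝ) 1) measurableSet_Icc
          exact eLpNorm_comp_measurePreserving hφ.aestronglyMeasurable hmp
  have h3 : eLpNorm (diff1 r h φ) p (volume.restrict (Ih r h)) ^ τ ≤
      (∑ j ∈ Finset.range (r+1), ‖(-1 : ℝ) ^ (r - j) * (r.choose j : ℝ)‖ₑ ^ τ) *
        eLpNorm φ p (volume.restrict (Set.Icc 0 1)) ^ τ := by
    refine key.trans ?_
    rw [Finset.sum_mul]
    refine Finset.sum_le_sum fun j hj => ?_
    rw [← ENNReal.mul_rpow_of_nonneg _ _ h0.le]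
    exact ENNReal.rpow_le_rpow (hterm j hj) h0.le
  have h4 := ENNReal.rpow_le_rpow h3 hτ'
  rw [← ENNReal.rpow_mul, mul_one_div_cancel h0.ne', ENNReal.rpow_one,
    ENNReal.mul_rpow_of_nonneg _ _ hτ', ← ENNReal.rpow_mul _ τ, mul_one_div_cancel h0.ne',
    ENNReal.rpow_one] at h4
  refine h4.trans (le_of_eq ?_)
  rw [ENNReal.coe_rpow_of_nonneg _ hτ']
  push_cast
  congr 3
  ext j
  rw [ENNReal.coe_rpow_of_nonneg _ h0.le, enorm_eq_nnnorm]

/-- The decay factor. -/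
def dec (lam : ℝ) (k m : ℕ) : ℝ := min 1 ((2:ℝ)^(lam * ((k:ℝ) - m)))

lemma U_comb (r : ℕ) (hr : 0 < r) (p : ℝ≥0∞) (hp : p ≠ 0) :
    ∃ K : NNReal, ∀ (k m : ℕ) (h : ℝ), |h| ≤ ((2:ℝ)^m)⁻¹ → ∀ φ ∈ TS k (r-1),
      eLpNorm (diff1 r h φ) p (volume.restrict (Ih r h)) ≤
        K * ENNReal.ofReal (dec ((r:ℝ) - 1 + p⁻¹.toReal) k m) *
          eLpNorm φ p (volume.restrict (Set.Icc 0 1)) := by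
  obtain ⟨K1, hK1⟩ := U_small r hr p hp
  obtain ⟨K2, hK2⟩ := U_trivial r p hp
  have hlam : 0 ≤ (r:ℝ) - 1 + p⁻¹.toReal := by
    have : (1:ℝ) ≤ r := by exact_mod_cast hr
    have : 0 ≤ p⁻¹.toReal := ENNReal.toReal_nonneg
    linarith
  refine ⟨max K1 K2, fun k m h hh φ hφ => ?_⟩
  by_cases hkm : k < m
  · refine (hK1 k m h hkm hh φ hφ).trans ?_
    gcongr
    · exact le_max_left _ _
    · refine le_min ?_ le_rfl
      apply Real.rpow_le_one_of_one_le_of_nonpos (by norm_num)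
      have : (k:ℝ) ≤ m := by exact_mod_cast hkm.le
      nlinarith
  · refine (hK2 h φ (TS_measurable hφ)).trans ?_
    gcongr
    rw [dec, min_eq_left]
    · simp
    · apply Real.one_le_rpow (by norm_num)
      have : (m:ℝ) ≤ k := by exact_mod_cast (not_lt.1 hkm)
      nlinarith

/-- iterated differences along a list -/
def foldD (d r : ℕ) (l : List (Fin d)) (h : Fin d → ℝ) (G : (Fin d → ℝ) → ℝ) : (Fin d → ℝ) → ℝ :=
  l.foldr (fun i g => diffC d r i (h i) g) G

lemma foldD_cons (d r : ℕ) (i : Fin d) (l : List (Fin d)) (h : Fin d → ℝ) (G : (Fin d → ℝ) → ℝ) :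
    foldD d r (i :: l) h G = diffC d r i (h i) (foldD d r l h G) := rfl

lemma shift_measurable {d : ℕ} (i : Fin d) (c : ℝ) :
    Measurable fun x : Fin d → ℝ => Function.update x i (x i + c) := by
  rw [measurable_pi_iff]
  intro j
  by_cases hj : j = i
  · subst hj; simp only [Function.update_self]; fun_prop
  · simp only [Function.update_of_ne hj]; fun_prop

lemma diffC_measurable {d r : ℕ} (i : Fin d) (h : ℝ) {F : (Fin d → ℝ) → ℝ} (hF : Measurable F) :
    Measurable (diffC d r i h F) := by
  unfold diffC
  exact Finset.measurable_sum _ fun j _ => (hF.comp (shift_measurable i _)).const_mul _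

lemma foldD_measurable {d r : ℕ} (l : List (Fin d)) (h : Fin d → ℝ) {G : (Fin d → ℝ) → ℝ}
    (hG : Measurable G) : Measurable (foldD d r l h G) := by
  induction l with
  | nil => exact hG
  | cons i l ih => rw [foldD_cons]; exact diffC_measurable i _ ih

lemma diffC_section (d r : ℕ) (i : Fin d) (h : ℝ) (F : (Fin d → ℝ) → ℝ) (x : Fin d → ℝ) (y : ℝ) :
    diffC d r i h F (Function.update x i y) =
      diff1 r h (fun y => F (Function.update x i y)) y := by
  unfold diffC diff1
  simp

lemma diffC_section_ne {d r k n : ℕ} {i j : Fin d} (hij : i ≠ j) (h : ℝ) {F : (Fin d → ℝ) → ℝ}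
    (hF : ∀ x, (fun y => F (Function.update x i y)) ∈ TS k n) (x : Fin d → ℝ) :
    (fun y => diffC d r j h F (Function.update x i y)) ∈ TS k n := by
  have : (fun y => diffC d r j h F (Function.update x i y)) =
      ∑ a ∈ Finset.range (r+1), ((-1 : ℝ) ^ (r - a) * (r.choose a : ℝ)) •
        (fun y => F (Function.update (Function.update x j (x j + a * h)) i y)) := by
    ext y
    simp only [diffC, Finset.sum_apply, Pi.smul_apply, smul_eq_mul]
    refine Finset.sum_congr rfl fun a _ => ?_
    rw [Function.update_of_ne hij.symm, Function.update_comm hij]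
  rw [this]
  exact Submodule.sum_mem _ fun a _ => Submodule.smul_mem _ _ (hF _)

lemma foldD_section {d r n : ℕ} {k : Fin d → ℕ} (l : List (Fin d)) (h : Fin d → ℝ)
    {G : (Fin d → ℝ) → ℝ}
    (hG : ∀ i x, (fun y => G (Function.update x i y)) ∈ TS (k i) n) (i : Fin d) (hi : i ∉ l)
    (x : Fin d → ℝ) : (fun y => foldD d r l h G (Function.update x i y)) ∈ TS (k i) n := by
  induction l generalizing x with
  | nil => exact hG i x
  | cons j l ih =>
    rw [List.mem_cons, not_or] at hi
    rw [foldD_cons]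
    exact diffC_section_ne hi.1 _ (ih hi.2) x

/-- domain for list differences -/
def Dl (d r : ℕ) (l : List (Fin d)) (h : Fin d → ℝ) : Set (Fin d → ℝ) :=
  {x | x ∈ cube d ∧ ∀ i ∈ l, x i + r * h i ∈ Set.Icc (0:ℝ) 1}

lemma cube_measurable (d : ℕ) : MeasurableSet (cube d) :=
  MeasurableSet.univ_pi fun _ => measurableSet_Icc

lemma mem_cube {d : ℕ} {x : Fin d → ℝ} : x ∈ cube d ↔ ∀ i, x i ∈ Set.Icc (0:ℝ) 1 := by
  simp only [cube, Set.mem_univ_pi]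

lemma Dl_measurable (d r : ℕ) (l : List (Fin d)) (h : Fin d → ℝ) : MeasurableSet (Dl d r l h) := by
  have : Dl d r l h = cube d ∩ ⋂ i ∈ l.toFinset, {x | x i + r * h i ∈ Set.Icc (0:ℝ) 1} := by
    ext x; simp [Dl]
  rw [this]
  refine (cube_measurable d).inter (Finset.measurableSet_biInter _ fun i _ => ?_)
  exact (by fun_prop : Measurable fun x : Fin d → ℝ => x i + r * h i) measurableSet_Icc

lemma Dl_update_cons {d r : ℕ} {i : Fin d} {l : List (Fin d)} (hi : i ∉ l) (h x : Fin d → ℝ) (y : ℝ) :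
    Function.update x i y ∈ Dl d r (i :: l) h ↔
      y ∈ Ih r (h i) ∧ ((∀ j, j ≠ i → x j ∈ Set.Icc (0:ℝ) 1) ∧
        ∀ j ∈ l, x j + r * h j ∈ Set.Icc (0:ℝ) 1) := by
  have e : ∀ j ∈ l, Function.update x i y j = x j := fun j hj =>
    Function.update_of_ne (fun (hji : j = i) => hi (hji ▸ hj)) _ _
  simp only [Dl, Set.mem_ofPred_eq, mem_cube, List.forall_mem_cons, Function.update_self, Ih]
  constructor
  · rintro ⟨h1, h2, h3⟩
    refine ⟨⟨by simpa using h1 i, h2⟩, fun j hj => by simpa [hj] using h1 j, fun j hj => ?_⟩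
    rw [← e j hj]; exact h3 j hj
  · rintro ⟨⟨h1, h2⟩, h3, h4⟩
    refine ⟨fun j => ?_, h2, fun j hj => ?_⟩
    · by_cases hj : j = i
      · subst hj; simpa using h1
      · simpa [hj] using h3 j hj
    · rw [e j hj]; exact h4 j hj

lemma Dl_update {d r : ℕ} {i : Fin d} {l : List (Fin d)} (hi : i ∉ l) (h x : Fin d → ℝ) (y : ℝ) :
    Function.update x i y ∈ Dl d r l h ↔
      y ∈ Set.Icc (0:ℝ) 1 ∧ ((∀ j, j ≠ i → x j ∈ Set.Icc (0:ℝ) 1) ∧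
        ∀ j ∈ l, x j + r * h j ∈ Set.Icc (0:ℝ) 1) := by
  have e : ∀ j ∈ l, Function.update x i y j = x j := fun j hj =>
    Function.update_of_ne (fun (hji : j = i) => hi (hji ▸ hj)) _ _
  simp only [Dl, Set.mem_ofPred_eq, mem_cube]
  constructor
  · rintro ⟨h1, h3⟩
    refine ⟨by simpa using h1 i, fun j hj => by simpa [hj] using h1 j, fun j hj => ?_⟩
    rw [← e j hj]; exact h3 j hj
  · rintro ⟨h1, h3, h4⟩
    refine ⟨fun j => ?_, fun j hj => ?_⟩
    · by_cases hj : j = i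
      · subst hj; simpa using h1
      · simpa [hj] using h3 j hj
    · rw [e j hj]; exact h4 j hj

lemma multi_list (r : ℕ) (hr : 0 < r) (p : ℝ≥0∞) (hp : p ≠ 0) :
    ∃ K : NNReal, ∀ (d : ℕ) (k m : Fin d → ℕ) (h : Fin d → ℝ) (l : List (Fin d)), l.Nodup →
      (∀ i ∈ l, |h i| ≤ ((2:ℝ)^(m i))⁻¹) → ∀ G ∈ SigmaRd d r k,
      eLpNorm ((Dl d r l h).indicator (foldD d r l h G)) p volume ≤
        (l.map fun i => (K:ℝ≥0∞) * ENNReal.ofReal (dec ((r:ℝ) - 1 + p⁻¹.toReal) (k i) (m i))).prod *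
          lpQ d p G := by
  obtain ⟨K, hK⟩ := U_comb r hr p hp
  refine ⟨K, fun d k m h l hl hh G hG => ?_⟩
  have hGm := Sigma_measurable hr hG
  have hGs := fun i x => Sigma_section hr hG i x
  induction l with
  | nil =>
    have : Dl d r [] h = cube d := by ext x; simp [Dl]
    rw [this, lpQ, eLpNorm_indicator_eq_eLpNorm_restrict (cube_measurable d)]
    simp [foldD]
  | cons i l ih =>
    rw [List.nodup_cons] at hl
    have ih' := ih hl.2 (fun j hj => hh j (List.mem_cons_of_mem _ hj))
    rw [List.map_cons, List.prod_cons, mul_assoc]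
    refine le_trans ?_ (mul_le_mul_right ih' _)
    have hFm := foldD_measurable (r := r) l h hGm
    refine eLpNorm_le_of_section hp i
      ((foldD_measurable (r := r) (i :: l) h hGm).indicator (Dl_measurable d r _ h))
      (hFm.indicator (Dl_measurable d r l h)) _ (by finiteness) fun x => ?_
    by_cases hQ : (∀ j, j ≠ i → x j ∈ Set.Icc (0:ℝ) 1) ∧ ∀ j ∈ l, x j + r * h j ∈ Set.Icc (0:ℝ) 1
    · have e1 : (fun y => (Dl d r (i :: l) h).indicator (foldD d r (i :: l) h G)
          (Function.update x i y)) = (Ih r (h i)).indicator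
            (diff1 r (h i) (fun y => foldD d r l h G (Function.update x i y))) := by
        ext y
        simp only [Set.indicator_apply, Dl_update_cons hl.1, and_iff_left hQ]
        rw [foldD_cons, diffC_section]
      have e2 : (fun y => (Dl d r l h).indicator (foldD d r l h G)
          (Function.update x i y)) = (Set.Icc (0:ℝ) 1).indicator
            (fun y => foldD d r l h G (Function.update x i y)) := by
        ext y
        simp only [Set.indicator_apply, Dl_update hl.1, and_iff_left hQ]
      rw [e1, e2, eLpNorm_indicator_eq_eLpNorm_restrict (Ih_measurable _ _),
        eLpNorm_indicator_eq_eLpNorm_restrict measurableSet_Icc]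
      exact hK (k i) (m i) (h i) (hh i (by simp)) _ (foldD_section l h hGs i hl.1 x)
    · have e1 : (fun y => (Dl d r (i :: l) h).indicator (foldD d r (i :: l) h G)
          (Function.update x i y)) = fun _ => 0 := by
        ext y
        simp only [Set.indicator_apply, Dl_update_cons hl.1, hQ, and_false, if_false]
      rw [e1]
      simp

lemma multi (r : ℕ) (hr : 0 < r) (p : ℝ≥0∞) (hp : p ≠ 0) :
    ∃ K : NNReal, ∀ (d : ℕ) (k m : Fin d → ℕ) (h : Fin d → ℝ) (e : Finset (Fin d)),
      (∀ i ∈ e, |h i| ≤ ((2:ℝ)^(m i))⁻¹) → ∀ G ∈ SigmaRd d r k,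
      eLpNorm (mixDiff d r e h G) p (volume.restrict (cubeHE d r h e)) ≤
        (∏ i ∈ e, (K:ℝ≥0∞) * ENNReal.ofReal (dec ((r:ℝ) - 1 + p⁻¹.toReal) (k i) (m i))) *
          lpQ d p G := by
  obtain ⟨K, hK⟩ := multi_list r hr p hp
  refine ⟨K, fun d k m h e hh G hG => ?_⟩
  have := hK d k m h e.toList e.nodup_toList (fun i hi => hh i (by simpa using hi)) G hG
  rw [eLpNorm_indicator_eq_eLpNorm_restrict (Dl_measurable _ _ _ _), Finset.prod_map_toList] at this
  have hD : cubeHE d r h e = Dl d r e.toList h := by ext x; simp [cubeHE, Dl]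
  rw [hD]
  exact this

lemma diffC_add (d r : ℕ) (i : Fin d) (h : ℝ) (f g : (Fin d → ℝ) → ℝ) :
    diffC d r i h (f + g) = diffC d r i h f + diffC d r i h g := by
  ext x
  simp only [diffC, Pi.add_apply, mul_add, Finset.sum_add_distrib]

lemma foldD_add (d r : ℕ) (l : List (Fin d)) (h : Fin d → ℝ) (f g : (Fin d → ℝ) → ℝ) :
    foldD d r l h (f + g) = foldD d r l h f + foldD d r l h g := by
  induction l with
  | nil => rfl
  | cons i l ih => rw [foldD_cons, foldD_cons, foldD_cons, ih, diffC_add]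

lemma foldD_zero (d r : ℕ) (l : List (Fin d)) (h : Fin d → ℝ) :
    foldD d r l h 0 = 0 := by
  have := foldD_add d r l h 0 0
  rw [add_zero] at this
  exact left_eq_add.1 this

lemma foldD_sum {ι : Type*} (d r : ℕ) (l : List (Fin d)) (h : Fin d → ℝ) (s : Finset ι)
    (f : ι → (Fin d → ℝ) → ℝ) :
    foldD d r l h (∑ k ∈ s, f k) = ∑ k ∈ s, foldD d r l h (f k) := by
  induction s using Finset.induction_on with
  | empty => simp [foldD_zero]
  | insert a s ha ih => rw [Finset.sum_insert ha, Finset.sum_insert ha, foldD_add, ih]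

lemma coef_sum (r : ℕ) :
    ∑ j ∈ Finset.range (r+1), ‖(-1 : ℝ) ^ (r - j) * (r.choose j : ℝ)‖ₑ = 2^r := by
  have h1 : ∀ j, ‖(-1 : ℝ) ^ (r - j) * (r.choose j : ℝ)‖ₑ = ((r.choose j : ℕ) : ℝ≥0∞) := by
    intro j
    rw [enorm_mul, enorm_pow]
    simp
  simp_rw [h1]
  exact_mod_cast congrArg (Nat.cast (R := ℝ≥0∞)) (Nat.sum_range_choose r)

lemma shift_Dl {d r : ℕ} {i : Fin d} {l : List (Fin d)} (hi : i ∉ l) {h x : Fin d → ℝ} {j : ℕ}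
    (hj : j ≤ r) (hx : x ∈ Dl d r (i :: l) h) :
    Function.update x i (x i + j * h i) ∈ Dl d r l h := by
  have h1 : Function.update x i (x i) ∈ Dl d r (i :: l) h := by simpa using hx
  rw [Dl_update_cons hi] at h1
  rw [Dl_update hi]
  refine ⟨?_, h1.2⟩
  obtain ⟨e1, e2⟩ := conv_between hj (x i) (h i)
  have hx := h1.1
  exact ⟨(le_min hx.1.1 hx.2.1).trans e1, e2.trans (max_le hx.1.2 hx.2.2)⟩

lemma update_eq_add {d : ℕ} (i : Fin d) (c : ℝ) (x : Fin d → ℝ) :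
    Function.update x i (x i + c) = x + Pi.single i c := by
  ext j
  by_cases hj : j = i
  · subst hj; simp
  · simp [hj]

lemma foldD_bound {d r : ℕ} (l : List (Fin d)) (hl : l.Nodup) (h : Fin d → ℝ) (f : (Fin d → ℝ) → ℝ)
    (ε : ℝ≥0∞) (hf : ∀ᵐ x : Fin d → ℝ, x ∈ cube d → ‖f x‖ₑ ≤ ε) :
    ∀ᵐ x : Fin d → ℝ, x ∈ Dl d r l h → ‖foldD d r l h f x‖ₑ ≤ (2^r)^l.length * ε := by
  induction l with
  | nil =>
    filter_upwards [hf] with x hx hxD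
    simpa [foldD] using hx hxD.1
  | cons i l ih =>
    rw [List.nodup_cons] at hl
    have ih' := ih hl.2
    have hs : ∀ᵐ x : Fin d → ℝ, ∀ j ∈ Finset.range (r+1),
        (Function.update x i (x i + j * h i)) ∈ Dl d r l h →
        ‖foldD d r l h f (Function.update x i (x i + j * h i))‖ₑ ≤ (2^r)^l.length * ε := by
      rw [ae_all_iff]
      intro j
      have := (measurePreserving_add_right (volume : Measure (Fin d → ℝ))
        (Pi.single i ((j:ℝ) * h i))).quasiMeasurePreserving.ae ih'
      filter_upwards [this] with x hx
      rw [update_eq_add]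
      exact fun _ => hx
    filter_upwards [hs] with x hx hxD
    rw [foldD_cons, diffC]
    refine (enorm_sum_le _ _).trans ?_
    calc _ ≤ ∑ j ∈ Finset.range (r+1), ‖(-1 : ℝ) ^ (r - j) * (r.choose j : ℝ)‖ₑ *
          ((2^r)^l.length * ε) := by
          refine Finset.sum_le_sum fun j hj => ?_
          rw [enorm_mul]
          gcongr
          exact hx j hj (shift_Dl hl.1 (by simp at hj; omega) hxD)
      _ = _ := by
          rw [← Finset.sum_mul, coef_sum, List.length_cons]; ring

lemma volume_cube (d : ℕ) : volume (cube d) = 1 := by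
  rw [cube, volume_pi_pi]
  simp

lemma conv_list {d r : ℕ} {p : ℝ≥0∞} {τ : ℝ} (h0 : 0 < τ) (h1 : τ ≤ 1)
    (hτp : ENNReal.ofReal τ ≤ p) (l : List (Fin d)) (hl : l.Nodup) (h : Fin d → ℝ)
    (g : (Fin d → ℝ) → ℝ) (gk : (Fin d → ℕ) → (Fin d → ℝ) → ℝ) (hgm : ∀ k, Measurable (gk k))
    (hconv : ConvLinf d gk g) :
    eLpNorm (foldD d r l h g) p (volume.restrict (Dl d r l h)) ^ τ ≤
      ∑' k, eLpNorm (foldD d r l h (gk k)) p (volume.restrict (Dl d r l h)) ^ τ := by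
  set ν := volume.restrict (Dl d r l h) with hν
  set M : ℝ≥0∞ := (2^r)^l.length with hM
  have hM0 : M ≠ 0 := by positivity
  have hMt : M ≠ ∞ := by rw [hM]; finiteness
  set ε : Finset (Fin d → ℕ) → ℝ≥0∞ := fun Δ =>
    eLpNorm (fun x => g x - ∑ k ∈ Δ, gk k x) ∞ (volume.restrict (cube d)) with hε
  have hν1 : ν Set.univ ≤ 1 := by
    rw [hν, Measure.restrict_apply_univ, ← volume_cube d]
    exact measure_mono fun x hx => hx.1
  have hmain : ∀ Δ, eLpNorm (foldD d r l h g) p ν ^ τ ≤ (M * ε Δ) ^ τ +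
      ∑' k, eLpNorm (foldD d r l h (gk k)) p ν ^ τ := by
    intro Δ
    by_cases hfin : ε Δ = ∞
    · rw [hfin, ENNReal.mul_top hM0, ENNReal.top_rpow_of_pos h0, top_add]; exact le_top
    set f : (Fin d → ℝ) → ℝ := fun x => g x - ∑ k ∈ Δ, gk k x with hf
    have hfb : ∀ᵐ x : Fin d → ℝ, x ∈ cube d → ‖f x‖ₑ ≤ ε Δ := by
      rw [← ae_restrict_iff' (cube_measurable d)]
      simp only [hε, eLpNorm_exponent_top]
      exact ae_le_eLpNormEssSup
    have hfold := foldD_bound (r := r) l hl h f (ε Δ) hfb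
    rw [← ae_restrict_iff' (Dl_measurable d r l h), ← hν] at hfold
    have hg : g = f + ∑ k ∈ Δ, gk k := by
      ext x; simp [hf]
    set c : ℝ := (M * ε Δ).toReal with hc
    have hcM : ENNReal.ofReal c = M * ε Δ := ENNReal.ofReal_toReal (ENNReal.mul_ne_top hMt hfin)
    have hc0 : 0 ≤ c := ENNReal.toReal_nonneg
    set S : (Fin d → ℝ) → ℝ := fun x => ∑ k ∈ Δ, foldD d r l h (gk k) x with hS
    have hkm : ∀ k, Measurable (foldD d r l h (gk k)) := fun k => foldD_measurable l h (hgm k)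
    have hSm : Measurable S := Finset.measurable_fun_sum _ fun k _ => hkm k
    have e1 : eLpNorm (foldD d r l h g) p ν ≤ eLpNorm (fun x => c + |S x|) p ν := by
      refine eLpNorm_mono_enorm_ae ?_
      filter_upwards [hfold] with x hx
      have : foldD d r l h g x = foldD d r l h f x + S x := by
        conv_lhs => rw [hg]
        rw [foldD_add, foldD_sum]
        simp [hS]
      rw [this]
      refine (enorm_add_le _ _).trans ?_
      rw [Real.enorm_eq_ofReal (r := c + |S x|) (by positivity), ENNReal.ofReal_add hc0 (abs_nonneg _),
        hcM, Real.enorm_eq_ofReal_abs (S x)]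
      gcongr
    have e2 : eLpNorm (fun _ : Fin d → ℝ => c) p ν ≤ M * ε Δ := by
      rw [← hcM]
      refine (eLpNorm_le_of_ae_bound (C := c) (.of_forall fun x => by simp [abs_of_nonneg hc0])).trans ?_
      calc _ ≤ 1 * ENNReal.ofReal c := by
            gcongr
            exact ENNReal.rpow_le_one hν1 (by positivity)
        _ = _ := one_mul _
    calc _ ≤ eLpNorm (fun x => c + |S x|) p ν ^ τ := by gcongr
      _ ≤ eLpNorm (fun _ => c) p ν ^ τ + eLpNorm (fun x => |S x|) p ν ^ τ :=
          eLpNorm_add_rpow_le h0 h1 hτp (by fun_prop) (by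
            have : Measurable fun x => |S x| := by
              simpa only [Real.norm_eq_abs] using hSm.norm
            exact this.aestronglyMeasurable)
      _ ≤ (M * ε Δ) ^ τ + ∑ k ∈ Δ, eLpNorm (foldD d r l h (gk k)) p ν ^ τ := by
          gcongr
          have : eLpNorm (fun x => |S x|) p ν = eLpNorm S p ν := eLpNorm_norm S
          rw [this]
          exact eLpNorm_sum_rpow_le h0 h1 hτp Δ _ fun k => (hkm k).aestronglyMeasurable
      _ ≤ _ := by
          gcongr
          exact ENNReal.sum_le_tsum _
  have hlim : Tendsto (fun Δ => (M * ε Δ) ^ τ +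
      ∑' k, eLpNorm (foldD d r l h (gk k)) p ν ^ τ) atTop
      (nhds (0 + ∑' k, eLpNorm (foldD d r l h (gk k)) p ν ^ τ)) := by
    refine Tendsto.add ?_ tendsto_const_nhds
    have : Tendsto (fun Δ => M * ε Δ) atTop (nhds (M * 0)) :=
      ENNReal.Tendsto.const_mul hconv (Or.inr hMt)
    have h3 := (ENNReal.continuous_rpow_const (y := τ)).tendsto (M * 0) |>.comp this
    rw [mul_zero, ENNReal.zero_rpow_of_pos h0] at h3
    exact h3
  rw [zero_add] at hlim
  exact ge_of_tendsto' hlim hmain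

lemma conv_mix {d r : ℕ} {p : ℝ≥0∞} {τ : ℝ} (h0 : 0 < τ) (h1 : τ ≤ 1)
    (hτp : ENNReal.ofReal τ ≤ p) (e : Finset (Fin d)) (h : Fin d → ℝ)
    (g : (Fin d → ℝ) → ℝ) (gk : (Fin d → ℕ) → (Fin d → ℝ) → ℝ) (hgm : ∀ k, Measurable (gk k))
    (hconv : ConvLinf d gk g) :
    eLpNorm (mixDiff d r e h g) p (volume.restrict (cubeHE d r h e)) ^ τ ≤
      ∑' k, eLpNorm (mixDiff d r e h (gk k)) p (volume.restrict (cubeHE d r h e)) ^ τ := by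
  have hD : cubeHE d r h e = Dl d r e.toList h := by ext x; simp [cubeHE, Dl]
  rw [hD]
  exact conv_list h0 h1 hτp e.toList e.nodup_toList h g gk hgm hconv

/-- weights -/
def wt (d : ℕ) (δ : ℝ) (k m : Fin d → ℕ) : ℝ := ∏ i, (2:ℝ)^(-δ * |(k i:ℝ) - m i|)

/-- discrete convolution -/
def bseq (d : ℕ) (δ τ : ℝ) (a : (Fin d → ℕ) → ℝ≥0∞) (m : Fin d → ℕ) : ℝ≥0∞ :=
  (∑' k, (ENNReal.ofReal (wt d δ k m) * a k) ^ τ) ^ (1/τ)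

lemma dyadic_cube (d : ℕ) (k : Fin d → ℕ) : dyadic d k ∈ cube d := by
  rw [mem_cube]; intro i
  exact ⟨by unfold dyadic; positivity, inv_le_one_of_one_le₀ (one_le_pow₀ (by norm_num))⟩

lemma dyadic_pos (d : ℕ) (k : Fin d → ℕ) (i : Fin d) : 0 < dyadic d k i := by
  unfold dyadic; positivity

lemma dyadic_rpow (d : ℕ) (k : Fin d → ℕ) (i : Fin d) (s : ℝ) :
    dyadic d k i ^ (-s) = (2:ℝ)^((k i : ℝ) * s) := by
  unfold dyadic
  rw [← Real.rpow_natCast, ← Real.rpow_neg (by norm_num), ← Real.rpow_mul (by norm_num)]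
  congr 1; ring

lemma dec_nonneg (l : ℝ) (k m : ℕ) : 0 ≤ dec l k m := le_min zero_le_one (by positivity)

lemma factor_bound {lam μ ρ δ : ℝ} (hμ : δ ≤ μ) (hlam : δ ≤ lam - ρ) (k m : ℕ) (x : ℝ)
    (hx1 : x ≤ 1) (hx : k < m → x ≤ (2:ℝ)^(lam * ((k:ℝ) - m))) :
    x * (2:ℝ)^(((max k m : ℕ):ℝ) * ρ) * (2:ℝ)^((m:ℝ) * μ) ≤
      (2:ℝ)^(-δ * |(k:ℝ) - m|) * (2:ℝ)^((k:ℝ) * ρ) * (2:ℝ)^(((max k m : ℕ):ℝ) * μ) := by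
  have h2 : (0:ℝ) < 2 := by norm_num
  rcases lt_or_ge k m with hkm | hkm
  · have hkm' : (k:ℝ) ≤ m := by exact_mod_cast hkm.le
    rw [max_eq_right hkm.le, abs_of_nonpos (by linarith)]
    refine mul_le_mul_of_nonneg_right ?_ (by positivity)
    calc x * (2:ℝ)^((m:ℝ) * ρ) ≤ (2:ℝ)^(lam * ((k:ℝ) - m)) * (2:ℝ)^((m:ℝ) * ρ) := by
          gcongr; exact hx hkm
      _ = (2:ℝ)^(lam * ((k:ℝ) - m) + (m:ℝ) * ρ) := by rw [Real.rpow_add h2]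
      _ ≤ (2:ℝ)^(-δ * -((k:ℝ) - m) + (k:ℝ) * ρ) := by
          apply Real.rpow_le_rpow_of_exponent_le (by norm_num)
          nlinarith
      _ = _ := by rw [Real.rpow_add h2]
  · have hkm' : (m:ℝ) ≤ k := by exact_mod_cast hkm
    rw [max_eq_left hkm, abs_of_nonneg (by linarith)]
    calc x * (2:ℝ)^((k:ℝ) * ρ) * (2:ℝ)^((m:ℝ) * μ) ≤ 1 * (2:ℝ)^((k:ℝ) * ρ) * (2:ℝ)^((m:ℝ) * μ) := by
          gcongr
      _ = (2:ℝ)^((k:ℝ) * ρ + (m:ℝ) * μ) := by rw [one_mul, Real.rpow_add h2]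
      _ ≤ (2:ℝ)^(-δ * ((k:ℝ) - m) + (k:ℝ) * ρ + (k:ℝ) * μ) := by
          apply Real.rpow_le_rpow_of_exponent_le (by norm_num)
          nlinarith
      _ = _ := by rw [Real.rpow_add h2, Real.rpow_add h2]

lemma omega_bound {d : ℕ} {Ω : (Fin d → ℝ) → ℝ} {lam μ ρ δ C₁ C₂ : ℝ}
    (hI : ∀ t : Fin d → ℝ, (∀ i, 0 < t i) → 0 < Ω t)
    (hμ : δ ≤ μ) (hlam : δ ≤ lam - ρ) (hC1 : 0 < C₁) (hC2 : 0 < C₂)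
    (ha : ∀ t t' : Fin d → ℝ, t ∈ cube d → t' ∈ cube d →
      (∀ i, 0 < t i) → (∀ i, t i ≤ t' i) →
      Ω t * ∏ i, t i ^ (-μ) ≤ C₁ * (Ω t' * ∏ i, t' i ^ (-μ)))
    (hb : ∀ t t' : Fin d → ℝ, t ∈ cube d → t' ∈ cube d →
      (∀ i, 0 < t i) → (∀ i, t i ≤ t' i) →
      Ω t * ∏ i, t i ^ (-ρ) ≥ C₂ * (Ω t' * ∏ i, t' i ^ (-ρ)))
    (e : Finset (Fin d)) (k m : Fin d → ℕ) (hm : ∀ i ∉ e, m i = 0) :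
    (∏ i ∈ e, dec lam (k i) (m i)) * Ω (dyadic d k) ≤ C₁ / C₂ * wt d δ k m * Ω (dyadic d m) := by
  set u : Fin d → ℕ := fun i => max (k i) (m i) with hu
  have hle : ∀ v : Fin d → ℕ, (∀ i, v i ≤ u i) → ∀ i, dyadic d u i ≤ dyadic d v i := by
    intro v hv i
    unfold dyadic
    exact inv_anti₀ (by positivity) (pow_le_pow_right₀ (by norm_num) (hv i))
  have h1 := ha (dyadic d u) (dyadic d m) (dyadic_cube _ _) (dyadic_cube _ _) (dyadic_pos _ _)
    (hle m fun i => le_max_right _ _)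
  have h2 := hb (dyadic d u) (dyadic d k) (dyadic_cube _ _) (dyadic_cube _ _) (dyadic_pos _ _)
    (hle k fun i => le_max_left _ _)
  simp only [dyadic_rpow] at h1 h2
  set A := ∏ i, (2:ℝ)^((k i:ℝ) * ρ) with hA
  set B := ∏ i, (2:ℝ)^((u i:ℝ) * ρ) with hB
  set D := ∏ i, (2:ℝ)^((u i:ℝ) * μ) with hD
  set E := ∏ i, (2:ℝ)^((m i:ℝ) * μ) with hE
  set X := ∏ i ∈ e, dec lam (k i) (m i) with hX
  set W := wt d δ k m with hW
  have hA0 : 0 < A := Finset.prod_pos fun i _ => by positivity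
  have hD0 : 0 < D := Finset.prod_pos fun i _ => by positivity
  have hB0 : 0 < B := Finset.prod_pos fun i _ => by positivity
  have hX0 : 0 ≤ X := Finset.prod_nonneg fun i _ => dec_nonneg _ _ _
  have hΩm := hI _ (dyadic_pos d m)
  have hXe : X = ∏ i, if i ∈ e then dec lam (k i) (m i) else 1 := by
    rw [hX, Finset.prod_ite_mem]; simp
  have key : X * B * E ≤ W * A * D := by
    rw [hXe, hB, hE, hW, wt, hA, hD, ← Finset.prod_mul_distrib, ← Finset.prod_mul_distrib,
      ← Finset.prod_mul_distrib, ← Finset.prod_mul_distrib]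
    refine Finset.prod_le_prod (fun i _ => ?_) (fun i _ => ?_)
    · have : 0 ≤ (if i ∈ e then dec lam (k i) (m i) else 1) := by
        split_ifs
        · exact dec_nonneg _ _ _
        · exact zero_le_one
      positivity
    · refine factor_bound hμ hlam (k i) (m i) _ ?_ ?_
      · split_ifs
        · exact min_le_left _ _
        · exact le_rfl
      · intro hkm
        by_cases hi : i ∈ e
        · rw [if_pos hi]; exact min_le_right _ _
        · rw [hm i hi] at hkm; omega
  have h3 : (X * Ω (dyadic d k) * C₂) * (A * D) ≤ (C₁ * W * Ω (dyadic d m)) * (A * D) := by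
    calc _ = X * D * (C₂ * (Ω (dyadic d k) * A)) := by ring
      _ ≤ X * D * (Ω (dyadic d u) * B) := by gcongr
      _ = X * B * (Ω (dyadic d u) * D) := by ring
      _ ≤ X * B * (C₁ * (Ω (dyadic d m) * E)) := by gcongr
      _ = C₁ * Ω (dyadic d m) * (X * B * E) := by ring
      _ ≤ C₁ * Ω (dyadic d m) * (W * A * D) := by gcongr
      _ = _ := by ring
  have h4 := le_of_mul_le_mul_right h3 (by positivity)
  rw [← le_div_iff₀ hC2] at h4
  refine h4.trans (le_of_eq ?_)
  ring

lemma main_pt {d r : ℕ} (hr : 0 < r) {p : ℝ≥0∞} (hp : p ≠ 0) {Ω : (Fin d → ℝ) → ℝ}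
    {μ ρ δ τ C₁ C₂ : ℝ} (h0 : 0 < τ) (h1 : τ ≤ 1) (hτp : ENNReal.ofReal τ ≤ p)
    (hI : ∀ t : Fin d → ℝ, (∀ i, 0 < t i) → 0 < Ω t)
    (hIII : ∀ γ : Fin d → ℝ, (∀ i, 1 ≤ γ i) → ∃ C' > (0:ℝ),
      ∀ lamv : Fin d → ℝ, (∀ i, 0 ≤ lamv i) → (∀ i, lamv i ≤ γ i) →
      ∀ t : Fin d → ℝ, (∀ i, 0 ≤ t i) → Ω (fun i => lamv i * t i) ≤ C' * Ω t)
    (hμ : δ ≤ μ) (hlam : δ ≤ ((r:ℝ) - 1 + p⁻¹.toReal) - ρ) (hC1 : 0 < C₁) (hC2 : 0 < C₂)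
    (ha : ∀ t t' : Fin d → ℝ, t ∈ cube d → t' ∈ cube d →
      (∀ i, 0 < t i) → (∀ i, t i ≤ t' i) →
      Ω t * ∏ i, t i ^ (-μ) ≤ C₁ * (Ω t' * ∏ i, t' i ^ (-μ)))
    (hb : ∀ t t' : Fin d → ℝ, t ∈ cube d → t' ∈ cube d →
      (∀ i, 0 < t i) → (∀ i, t i ≤ t' i) →
      Ω t * ∏ i, t i ^ (-ρ) ≥ C₂ * (Ω t' * ∏ i, t' i ^ (-ρ))) (e : Finset (Fin d)) :
    ∃ C : NNReal, ∀ (g : (Fin d → ℝ) → ℝ) (gk : (Fin d → ℕ) → (Fin d → ℝ) → ℝ),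
      (∀ k, gk k ∈ SigmaRd d r k) → ConvLinf d gk g →
      ∀ m : Fin d → ℕ, (∀ i ∉ e, m i = 0) → ∀ t : Fin d → ℝ,
      (∀ i ∈ e, t i ≤ ((2:ℝ)^(m i))⁻¹ ∧ ((2:ℝ)^(m i))⁻¹ ≤ 2 * t i) →
      modulus d r e p g t / ENNReal.ofReal (Ω (tE d e t)) ≤
        C * bseq d δ τ (fun k => lpQ d p (gk k) / ENNReal.ofReal (Ω (dyadic d k))) m := by
  obtain ⟨K, hK⟩ := multi r hr p hp
  obtain ⟨C', hC', hIII'⟩ := hIII (fun _ => 2) (fun _ => by norm_num)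
  refine ⟨K ^ e.card * (C₁ / C₂ * C').toNNReal, fun g gk hgk hconv m hm t ht => ?_⟩
  set a : (Fin d → ℕ) → ℝ≥0∞ := fun k => lpQ d p (gk k) / ENNReal.ofReal (Ω (dyadic d k)) with ha'
  set lam := (r:ℝ) - 1 + p⁻¹.toReal with hlam'
  have htE : ∀ i, 0 < tE d e t i := by
    intro i
    unfold tE
    split_ifs with hi
    · have := (ht i hi).2
      have h2 : (0:ℝ) < ((2:ℝ)^(m i))⁻¹ := by positivity
      linarith
    · exact one_pos
  have hΩt := hI _ htE
  have hΩ : Ω (dyadic d m) ≤ C' * Ω (tE d e t) := by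
    have := hIII' (fun i => dyadic d m i / tE d e t i)
      (fun i => div_nonneg (dyadic_pos _ _ _).le (htE i).le) (fun i => by
        rw [div_le_iff₀ (htE i)]
        by_cases hi : i ∈ e
        · simp only [tE, hi, if_true, dyadic]; exact (ht i hi).2
        · simp [tE, hi, dyadic, hm i hi]) (tE d e t) (fun i => (htE i).le)
    convert this using 2
    ext i
    rw [div_mul_cancel₀ _ (htE i).ne']
  set Cc : ℝ≥0∞ := (K:ℝ≥0∞) ^ e.card * ENNReal.ofReal (C₁ / C₂ * C') with hCc
  have hak : ∀ k, lpQ d p (gk k) = a k * ENNReal.ofReal (Ω (dyadic d k)) := by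
    intro k
    rw [ha']
    simp only
    rw [ENNReal.div_mul_cancel]
    · have := hI _ (dyadic_pos d k)
      simpa using this
    · exact ENNReal.ofReal_ne_top
  have hterm : ∀ k, (∏ i ∈ e, (K:ℝ≥0∞) * ENNReal.ofReal (dec lam (k i) (m i))) * lpQ d p (gk k) ≤
      (Cc * ENNReal.ofReal (Ω (tE d e t))) * (ENNReal.ofReal (wt d δ k m) * a k) := by
    intro k
    have hob := omega_bound hI hμ hlam hC1 hC2 ha hb e k m hm
    have hwt : 0 ≤ wt d δ k m := Finset.prod_nonneg fun i _ => by positivity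
    have hob2 : (∏ i ∈ e, dec lam (k i) (m i)) * Ω (dyadic d k) ≤
        (C₁ / C₂ * C') * wt d δ k m * Ω (tE d e t) := by
      refine hob.trans ?_
      calc _ ≤ C₁ / C₂ * wt d δ k m * (C' * Ω (tE d e t)) := by gcongr
        _ = _ := by ring
    have hdn : ∀ i ∈ e, 0 ≤ dec lam (k i) (m i) := fun i _ => dec_nonneg _ _ _
    have hob3 := ENNReal.ofReal_le_ofReal hob2
    rw [ENNReal.ofReal_mul (Finset.prod_nonneg hdn), ENNReal.ofReal_prod_of_nonneg hdn,
      ENNReal.ofReal_mul (by positivity), ENNReal.ofReal_mul (p := C₁ / C₂ * C') (by positivity)] at hob3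
    rw [Finset.prod_mul_distrib, Finset.prod_const, hak]
    calc _ = (K:ℝ≥0∞) ^ e.card * ((∏ i ∈ e, ENNReal.ofReal (dec lam (k i) (m i))) *
          ENNReal.ofReal (Ω (dyadic d k))) * a k := by ring
      _ ≤ _ := mul_le_mul_left (mul_le_mul_right hob3 _) _
      _ = _ := by rw [hCc]; ring
  have hτ' : 0 ≤ 1/τ := by positivity
  have hmod : modulus d r e p g t ≤ (Cc * ENNReal.ofReal (Ω (tE d e t))) * bseq d δ τ a m := by
    unfold modulus
    refine iSup₂_le fun h hh => ?_
    have hc := conv_mix (r := r) h0 h1 hτp e h g gk (fun k => Sigma_measurable hr (hgk k)) hconv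
    have hc2 : eLpNorm (mixDiff d r e h g) p (volume.restrict (cubeHE d r h e)) ^ τ ≤
        (Cc * ENNReal.ofReal (Ω (tE d e t))) ^ τ *
          ∑' k, (ENNReal.ofReal (wt d δ k m) * a k) ^ τ := by
      refine hc.trans ?_
      rw [← ENNReal.tsum_mul_left]
      refine ENNReal.tsum_le_tsum fun k => ?_
      rw [← ENNReal.mul_rpow_of_nonneg _ _ h0.le]
      refine ENNReal.rpow_le_rpow ?_ h0.le
      exact (hK d k m h e (fun i hi => (hh i hi).le.trans (ht i hi).1) (gk k) (hgk k)).trans (hterm k)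
    have hc3 := ENNReal.rpow_le_rpow hc2 hτ'
    rw [ENNReal.mul_rpow_of_nonneg _ _ hτ', ← ENNReal.rpow_mul, ← ENNReal.rpow_mul,
      mul_one_div_cancel h0.ne', ENNReal.rpow_one, ENNReal.rpow_one] at hc3
    exact hc3
  have hCC : ((K ^ e.card * (C₁ / C₂ * C').toNNReal : NNReal) : ℝ≥0∞) = Cc := by
    rw [hCc]; push_cast; rfl
  rw [hCC]
  refine ENNReal.div_le_of_le_mul (hmod.trans (le_of_eq ?_))
  ring

lemma E1_ne_top {η : ℝ} (hη : 0 < η) :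
    (∑' z : ℤ, ENNReal.ofReal ((2:ℝ) ^ (-η * |(z:ℝ)|))) ≠ ∞ := by
  have hq : (2:ℝ) ^ (-η) < 1 := Real.rpow_lt_one_of_one_lt_of_neg (by norm_num) (by linarith)
  have hterm : ∀ n : ℕ, ENNReal.ofReal ((2:ℝ) ^ (-η * (n:ℝ))) = ENNReal.ofReal ((2:ℝ) ^ (-η)) ^ n := by
    intro n
    rw [Real.rpow_mul (by norm_num), Real.rpow_natCast, ENNReal.ofReal_pow (by positivity)]
  have hg : (∑' n : ℕ, ENNReal.ofReal ((2:ℝ) ^ (-η)) ^ n) ≠ ∞ := by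
    rw [ENNReal.tsum_geometric, ENNReal.inv_ne_top, Ne, tsub_eq_zero_iff_le, not_le]
    rw [← ENNReal.ofReal_one]
    exact (ENNReal.ofReal_lt_ofReal_iff (by norm_num)).2 hq
  rw [tsum_of_nat_of_neg_add_one ENNReal.summable ENNReal.summable]
  refine ENNReal.add_ne_top.2 ⟨?_, ?_⟩
  · refine ne_top_of_le_ne_top hg (ENNReal.tsum_le_tsum fun n => ?_)
    rw [← hterm]
    simp
  · refine ne_top_of_le_ne_top hg (ENNReal.tsum_le_tsum fun n => ?_)
    rw [← hterm]
    refine ENNReal.ofReal_le_ofReal (Real.rpow_le_rpow_of_exponent_le (by norm_num) ?_)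
    have : |((-((n:ℤ) + 1) : ℤ) : ℝ)| = n + 1 := by
      push_cast
      rw [abs_of_nonpos (by have := Nat.cast_nonneg (α := ℝ) n; linarith)]
      ring
    rw [this]
    nlinarith

lemma E1_le {η : ℝ} (m : ℕ) :
    (∑' n : ℕ, ENNReal.ofReal ((2:ℝ) ^ (-η * |(n:ℝ) - m|))) ≤
      ∑' z : ℤ, ENNReal.ofReal ((2:ℝ) ^ (-η * |(z:ℝ)|)) := by
  have hinj : Function.Injective (fun n : ℕ => (n:ℤ) - m) := by
    intro a b h
    simp at h
    exact h
  refine le_trans (le_of_eq ?_) (ENNReal.tsum_comp_le_tsum_of_injective hinj _)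
  refine tsum_congr fun n => ?_
  push_cast
  rfl

lemma tsum_prod_le (d : ℕ) (f : Fin d → ℕ → ℝ≥0∞) :
    (∑' k : Fin d → ℕ, ∏ i, f i (k i)) ≤ ∏ i, ∑' n, f i n := by
  rw [ENNReal.tsum_eq_iSup_sum]
  refine iSup_le fun s => ?_
  let t : Fin d → Finset ℕ := fun i => s.image fun k => k i
  have hs : s ⊆ Fintype.piFinset t := by
    intro k hk
    rw [Fintype.mem_piFinset]
    intro i
    exact Finset.mem_image_of_mem (fun k : Fin d → ℕ => k i) hk
  calc _ ≤ ∑ k ∈ Fintype.piFinset t, ∏ i, f i (k i) :=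
        Finset.sum_le_sum_of_subset hs
    _ = ∏ i, ∑ n ∈ t i, f i n := (Finset.prod_univ_sum _ _).symm
    _ ≤ _ := Finset.prod_le_prod' fun i _ => ENNReal.sum_le_tsum _

/-- The total weight. -/
def Wsum (d : ℕ) (η : ℝ) : ℝ≥0∞ := (∑' z : ℤ, ENNReal.ofReal ((2:ℝ) ^ (-η * |(z:ℝ)|))) ^ d

lemma Wsum_ne_top {d : ℕ} {η : ℝ} (hη : 0 < η) : Wsum d η ≠ ∞ :=
  ENNReal.pow_ne_top (E1_ne_top hη)

lemma wt_symm (d : ℕ) (η : ℝ) (k m : Fin d → ℕ) : wt d η k m = wt d η m k := by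
  unfold wt
  refine Finset.prod_congr rfl fun i _ => ?_
  rw [abs_sub_comm]

lemma wt_rpow (d : ℕ) {δ τ : ℝ} (hτ : 0 ≤ τ) (k m : Fin d → ℕ) :
    ENNReal.ofReal (wt d δ k m) ^ τ = ENNReal.ofReal (wt d (δ * τ) k m) := by
  have h : 0 ≤ wt d δ k m := Finset.prod_nonneg fun i _ => by positivity
  rw [ENNReal.ofReal_rpow_of_nonneg h hτ]
  congr 1
  unfold wt
  rw [← Real.finsetProd_rpow _ _ (fun i _ => by positivity)]
  refine Finset.prod_congr rfl fun i _ => ?_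
  rw [← Real.rpow_mul (by norm_num)]
  congr 1
  ring

lemma wt_sum_le (d : ℕ) (η : ℝ) (m : Fin d → ℕ) :
    (∑' k, ENNReal.ofReal (wt d η k m)) ≤ Wsum d η := by
  have h1 : ∀ k : Fin d → ℕ, ENNReal.ofReal (wt d η k m) =
      ∏ i, ENNReal.ofReal ((2:ℝ) ^ (-η * |(k i:ℝ) - m i|)) := fun k => by
    unfold wt
    rw [ENNReal.ofReal_prod_of_nonneg fun i _ => by positivity]
  simp_rw [h1]
  refine (tsum_prod_le d fun i n => ENNReal.ofReal ((2:ℝ) ^ (-η * |(n:ℝ) - m i|))).trans ?_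
  refine (Finset.prod_le_prod' fun i _ => E1_le (m i)).trans ?_
  rw [Finset.prod_const, Wsum]
  simp

lemma jensen_tsum {ι : Type*} {s : ℝ} (hs : 1 ≤ s) (w f : ι → ℝ≥0∞) {A : ℝ≥0∞}
    (hA : ∑' k, w k ≤ A) :
    (∑' k, w k * f k) ^ s ≤ A ^ (s - 1) * ∑' k, w k * f k ^ s := by
  have hs0 : 0 < s := by linarith
  have h1 : ∑' k, w k * f k ≤ A ^ (1 - s⁻¹) * (∑' k, w k * f k ^ s) ^ s⁻¹ := by
    rw [ENNReal.tsum_eq_iSup_sum]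
    refine iSup_le fun S => ?_
    refine (ENNReal.inner_le_weight_mul_Lp_of_nonneg S hs w f).trans ?_
    refine mul_le_mul' ?_ ?_
    · refine ENNReal.rpow_le_rpow ((ENNReal.sum_le_tsum S).trans hA) ?_
      have := inv_le_one_of_one_le₀ hs
      linarith
    · exact ENNReal.rpow_le_rpow (ENNReal.sum_le_tsum S) (by positivity)
  refine (ENNReal.rpow_le_rpow h1 hs0.le).trans (le_of_eq ?_)
  rw [ENNReal.mul_rpow_of_nonneg _ _ hs0.le, ← ENNReal.rpow_mul, ← ENNReal.rpow_mul,
    inv_mul_cancel₀ hs0.ne', ENNReal.rpow_one]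
  congr 2
  field_simp

lemma bseq_eq {d : ℕ} {δ τ : ℝ} (h0 : 0 < τ) (a : (Fin d → ℕ) → ℝ≥0∞) (m : Fin d → ℕ) :
    bseq d δ τ a m = (∑' k, ENNReal.ofReal (wt d (δ * τ) k m) * a k ^ τ) ^ (1/τ) := by
  unfold bseq
  congr 1
  refine tsum_congr fun k => ?_
  rw [ENNReal.mul_rpow_of_nonneg _ _ h0.le, wt_rpow d h0.le]

lemma bseq_sup {d : ℕ} {δ τ : ℝ} (h0 : 0 < τ) (a : (Fin d → ℕ) → ℝ≥0∞) (m : Fin d → ℕ) :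
    bseq d δ τ a m ≤ Wsum d (δ * τ) ^ (1/τ) * ⨆ k, a k := by
  rw [bseq_eq h0]
  have h : (∑' k, ENNReal.ofReal (wt d (δ * τ) k m) * a k ^ τ) ≤
      Wsum d (δ * τ) * (⨆ k, a k) ^ τ := by
    refine le_trans ?_ (mul_le_mul_left (wt_sum_le d (δ * τ) m) _)
    rw [← ENNReal.tsum_mul_right]
    refine ENNReal.tsum_le_tsum fun k => ?_
    exact mul_le_mul_right (ENNReal.rpow_le_rpow (le_iSup a k) h0.le) _
  refine (ENNReal.rpow_le_rpow h (by positivity)).trans (le_of_eq ?_)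
  rw [ENNReal.mul_rpow_of_nonneg _ _ (by positivity), ← ENNReal.rpow_mul,
    mul_one_div_cancel h0.ne', ENNReal.rpow_one]

lemma bseq_hardy {d : ℕ} {δ τ q : ℝ} (h0 : 0 < τ) (hq : τ ≤ q) (a : (Fin d → ℕ) → ℝ≥0∞) :
    ∑' m, bseq d δ τ a m ^ q ≤ Wsum d (δ * τ) ^ (q/τ - 1) * (Wsum d (δ * τ) * ∑' k, a k ^ q) := by
  have hs : 1 ≤ q / τ := (one_le_div h0).2 hq
  have h1 : ∀ m, bseq d δ τ a m ^ q ≤ Wsum d (δ * τ) ^ (q/τ - 1) *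
      ∑' k, ENNReal.ofReal (wt d (δ * τ) k m) * a k ^ q := by
    intro m
    rw [bseq_eq h0, ← ENNReal.rpow_mul, one_div_mul_eq_div]
    refine (jensen_tsum hs _ _ (wt_sum_le d (δ * τ) m)).trans (le_of_eq ?_)
    congr 1
    refine tsum_congr fun k => ?_
    rw [← ENNReal.rpow_mul, mul_div_cancel₀ _ h0.ne']
  refine (ENNReal.tsum_le_tsum h1).trans ?_
  rw [ENNReal.tsum_mul_left, ENNReal.tsum_comm]
  refine mul_le_mul_right ?_ _
  rw [← ENNReal.tsum_mul_left]
  refine ENNReal.tsum_le_tsum fun k => ?_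
  rw [ENNReal.tsum_mul_right]
  refine mul_le_mul_left ?_ _
  simp_rw [fun m => wt_symm d (δ * τ) k m]
  exact wt_sum_le d (δ * τ) k

lemma pick_m {d : ℕ} (e : Finset (Fin d)) (t : Fin d → ℝ) (ht : t ∈ cube d)
    (h0 : ∀ i ∈ e, 0 < t i) : ∃ m : Fin d → ℕ, (∀ i ∉ e, m i = 0) ∧
      ∀ i ∈ e, ((2:ℝ) ^ (m i + 1))⁻¹ < t i ∧ t i ≤ ((2:ℝ) ^ (m i))⁻¹ := by
  have h : ∀ i, ∃ n : ℕ, (i ∉ e → n = 0) ∧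
      (i ∈ e → ((2:ℝ) ^ (n + 1))⁻¹ < t i ∧ t i ≤ ((2:ℝ) ^ n)⁻¹) := by
    intro i
    by_cases hi : i ∈ e
    · obtain ⟨n, hn⟩ := exists_nat_pow_near_of_lt_one (y := (2:ℝ)⁻¹) (h0 i hi) (mem_cube.1 ht i).2
        (by norm_num) (by norm_num)
      refine ⟨n, fun h => absurd hi h, fun _ => ?_⟩
      simpa only [inv_pow] using hn
    · exact ⟨0, fun _ => rfl, fun h => absurd h hi⟩
  choose m hm using h
  exact ⟨m, fun i hi => (hm i).1 hi, fun i hi => (hm i).2 hi⟩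

lemma modulus_zero {d r : ℕ} {e : Finset (Fin d)} {p : ℝ≥0∞} {g : (Fin d → ℝ) → ℝ} {t : Fin d → ℝ}
    {i : Fin d} (hi : i ∈ e) (h : t i ≤ 0) : modulus d r e p g t = 0 := by
  unfold modulus
  refine le_antisymm (iSup₂_le fun h' hh => ?_) bot_le
  have := hh i hi
  have := abs_nonneg (h' i)
  linarith

/-- Dyadic box. -/
def dbox (d : ℕ) (e : Finset (Fin d)) (m : Fin d → ℕ) : Set (Fin d → ℝ) :=
  Set.univ.pi fun i => if i ∈ e then Set.Ioc ((2:ℝ) ^ (m i + 1))⁻¹ ((2:ℝ) ^ (m i))⁻¹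
    else Set.Icc (0:ℝ) 1

lemma dbox_measurable (d : ℕ) (e : Finset (Fin d)) (m : Fin d → ℕ) :
    MeasurableSet (dbox d e m) := by
  refine MeasurableSet.univ_pi fun i => ?_
  split_ifs
  · exact measurableSet_Ioc
  · exact measurableSet_Icc

lemma dbox_volume (d : ℕ) (e : Finset (Fin d)) (m : Fin d → ℕ) :
    (∏ i ∈ e, ENNReal.ofReal ((2:ℝ) ^ (m i + 1))) * volume (dbox d e m) = 1 := by
  unfold dbox
  rw [volume_pi_pi, ← Finset.prod_subset (Finset.subset_univ e), ← Finset.prod_mul_distrib]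
  · refine Finset.prod_eq_one fun i hi => ?_
    rw [if_pos hi, Real.volume_Ioc, ← ENNReal.ofReal_mul (by positivity), ← ENNReal.ofReal_one]
    congr 1
    have : (2:ℝ) ^ (m i) ≠ 0 := by positivity
    rw [pow_succ]
    field_simp
    norm_num
  · intro i _ hi
    rw [if_neg hi]
    simp

lemma int_le {d : ℕ} (e : Finset (Fin d)) {q : ℝ} (hq : 0 < q) (F : (Fin d → ℝ) → ℝ≥0∞)
    (b : (Fin d → ℕ) → ℝ≥0∞) (hF0 : ∀ t, ∀ i ∈ e, t i ≤ 0 → F t = 0)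
    (hF : ∀ m : Fin d → ℕ, (∀ i ∉ e, m i = 0) → ∀ t,
      (∀ i ∈ e, t i ≤ ((2:ℝ)^(m i))⁻¹ ∧ ((2:ℝ)^(m i))⁻¹ ≤ 2 * t i) → F t ≤ b m) :
    (∫⁻ t in cube d, F t ^ q * ∏ i ∈ e, ENNReal.ofReal (t i)⁻¹) ≤ ∑' m, b m ^ q := by
  have hpt : ∀ t ∈ cube d, F t ^ q * ∏ i ∈ e, ENNReal.ofReal (t i)⁻¹ ≤
      ∑' m, (dbox d e m).indicator
        (fun _ => b m ^ q * ∏ i ∈ e, ENNReal.ofReal ((2:ℝ) ^ (m i + 1))) t := by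
    intro t ht
    by_cases h : ∀ i ∈ e, 0 < t i
    · obtain ⟨m, hm0, hm⟩ := pick_m e t ht h
      refine le_trans ?_ (ENNReal.le_tsum m)
      rw [Set.indicator_of_mem]
      · refine mul_le_mul' (ENNReal.rpow_le_rpow (hF m hm0 t fun i hi => ⟨(hm i hi).2, ?_⟩) hq.le) ?_
        · have := (hm i hi).1
          rw [pow_succ, mul_inv] at this
          linarith
        · refine Finset.prod_le_prod' fun i hi => ENNReal.ofReal_le_ofReal ?_
          exact inv_le_of_inv_le₀ (by positivity) (hm i hi).1.le
      · rw [dbox, Set.mem_univ_pi]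
        intro i
        split_ifs with hi
        · exact hm i hi
        · exact mem_cube.1 ht i
    · push Not at h
      obtain ⟨i, hi, hti⟩ := h
      rw [hF0 t i hi hti, ENNReal.zero_rpow_of_pos hq, zero_mul]
      exact bot_le
  refine (setLIntegral_mono' (cube_measurable d) hpt).trans ((setLIntegral_le_lintegral _ _).trans ?_)
  rw [lintegral_tsum fun m => (measurable_const.indicator (dbox_measurable d e m)).aemeasurable]
  refine ENNReal.tsum_le_tsum fun m => ?_
  rw [lintegral_indicator_const (dbox_measurable d e m), mul_assoc, dbox_volume, mul_one]

lemma semi_le {d r : ℕ} (hr : 0 < r) {p θ : ℝ≥0∞} (hp : p ≠ 0) (hθ : θ ≠ 0) {μ ρ C₁ C₂ : ℝ}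
    {Ω : (Fin d → ℝ) → ℝ}
    (hI : ∀ t : Fin d → ℝ, (∀ i, 0 < t i) → 0 < Ω t)
    (hIII : ∀ γ : Fin d → ℝ, (∀ i, 1 ≤ γ i) → ∃ C' > (0:ℝ),
      ∀ lamv : Fin d → ℝ, (∀ i, 0 ≤ lamv i) → (∀ i, lamv i ≤ γ i) →
      ∀ t : Fin d → ℝ, (∀ i, 0 ≤ t i) → Ω (fun i => lamv i * t i) ≤ C' * Ω t)
    (hμ : 0 < μ) (hρ : ρ < min (r : ℝ) ((r : ℝ) - 1 + p⁻¹.toReal))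
    (hC1 : 0 < C₁) (hC2 : 0 < C₂)
    (ha : ∀ t t' : Fin d → ℝ, t ∈ cube d → t' ∈ cube d →
      (∀ i, 0 < t i) → (∀ i, t i ≤ t' i) →
      Ω t * ∏ i, t i ^ (-μ) ≤ C₁ * (Ω t' * ∏ i, t' i ^ (-μ)))
    (hb : ∀ t t' : Fin d → ℝ, t ∈ cube d → t' ∈ cube d →
      (∀ i, 0 < t i) → (∀ i, t i ≤ t' i) →
      Ω t * ∏ i, t i ^ (-ρ) ≥ C₂ * (Ω t' * ∏ i, t' i ^ (-ρ)))
    (e : Finset (Fin d)) :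
    ∃ C : NNReal, ∀ (g : (Fin d → ℝ) → ℝ) (gk : (Fin d → ℕ) → (Fin d → ℝ) → ℝ),
      (∀ k, gk k ∈ SigmaRd d r k) → ConvLinf d gk g →
      besovSemi d r p θ Ω e g ≤ C * B4seq d p θ Ω gk := by
  obtain ⟨τ, h0, h1, hτp, hτθ⟩ := exists_tau p θ hp hθ
  have hlam : ρ < (r : ℝ) - 1 + p⁻¹.toReal := hρ.trans_le (min_le_right _ _)
  set δ := min μ (((r:ℝ) - 1 + p⁻¹.toReal) - ρ) with hδ
  have hδ0 : 0 < δ := lt_min hμ (by linarith)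
  have hη : 0 < δ * τ := mul_pos hδ0 h0
  obtain ⟨C, hC⟩ := main_pt hr hp h0 h1 hτp hI hIII (min_le_left _ _ : δ ≤ μ)
    (min_le_right _ _ : δ ≤ ((r:ℝ) - 1 + p⁻¹.toReal) - ρ) hC1 hC2 ha hb e
  have hA := Wsum_ne_top (d := d) hη
  have hF0 : ∀ (g : (Fin d → ℝ) → ℝ) (t : Fin d → ℝ), ∀ i ∈ e, t i ≤ 0 →
      modulus d r e p g t / ENNReal.ofReal (Ω (tE d e t)) = 0 := by
    intro g t i hi hti
    rw [modulus_zero hi hti, ENNReal.zero_div]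
  by_cases hθt : θ = ∞
  · refine ⟨C * (Wsum d (δ * τ) ^ (1/τ)).toNNReal, fun g gk hgk hconv => ?_⟩
    have hA' : Wsum d (δ * τ) ^ (1/τ) ≠ ∞ := ENNReal.rpow_ne_top_of_nonneg (by positivity) hA
    rw [besovSemi, B4seq, if_pos hθt, if_pos hθt]
    push_cast
    rw [ENNReal.coe_toNNReal hA']
    refine iSup₂_le fun t ht => ?_
    by_cases h : ∀ i ∈ e, 0 < t i
    · obtain ⟨m, hm0, hm⟩ := pick_m e t ht h
      refine (hC g gk hgk hconv m hm0 t fun i hi => ⟨(hm i hi).2, ?_⟩).trans ?_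
      · have := (hm i hi).1
        rw [pow_succ, mul_inv] at this
        linarith
      · rw [mul_assoc]
        exact mul_le_mul_right (bseq_sup h0 _ m) _
    · push Not at h
      obtain ⟨i, hi, hti⟩ := h
      rw [hF0 g t i hi hti]
      exact bot_le
  · set q := θ.toReal with hq
    have hq0 : 0 < q := ENNReal.toReal_pos hθ hθt
    have hτq : τ ≤ q := (ENNReal.ofReal_le_iff_le_toReal hθt).1 hτθ
    set D : ℝ≥0∞ := (C:ℝ≥0∞) ^ q * (Wsum d (δ * τ) ^ (q/τ - 1) * Wsum d (δ * τ)) with hD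
    have hD' : D ^ (1/q) ≠ ∞ := by
      refine ENNReal.rpow_ne_top_of_nonneg (by positivity) ?_
      refine ENNReal.mul_ne_top (ENNReal.rpow_ne_top_of_nonneg hq0.le ENNReal.coe_ne_top)
        (ENNReal.mul_ne_top (ENNReal.rpow_ne_top_of_nonneg ?_ hA) hA)
      have := (one_le_div h0).2 hτq
      linarith
    refine ⟨(D ^ (1/q)).toNNReal, fun g gk hgk hconv => ?_⟩
    rw [besovSemi, B4seq, if_neg hθt, if_neg hθt, ENNReal.coe_toNNReal hD', ← hq,
      ← ENNReal.mul_rpow_of_nonneg _ _ (by positivity)]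
    refine ENNReal.rpow_le_rpow ?_ (by positivity)
    refine (int_le e hq0 _ _ (hF0 g) (hC g gk hgk hconv)).trans ?_
    simp_rw [ENNReal.mul_rpow_of_nonneg _ _ hq0.le]
    rw [ENNReal.tsum_mul_left, hD, mul_assoc]
    refine mul_le_mul_right ((bseq_hardy h0 hτq _).trans (le_of_eq ?_)) _
    rw [mul_assoc]

end SparseGrid

open SparseGrid MeasureTheory in
/-- If `Ω` satisfies (I)–(III) and (a),(b) with `μ > 0` and
`ρ < min(r, r-1+1/p)`, and `g = ∑_k g_k` with `g_k ∈ Σ_r^d(k)` converges in `L_∞(𝕀^d)`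
with `B_4(g) < ∞`, then `g ∈ B^Ω_{p,θ}` and `‖g‖_{B^Ω_{p,θ}} ≤ C B_4(g)`. -/
theorem statement5 (d r : ℕ) (hd : 0 < d) (hr : 0 < r)
    (p θ : ℝ≥0∞) (hp : 0 < p) (hθ : 0 < θ)
    (μ ρ : ℝ) (Ω : (Fin d → ℝ) → ℝ)
    -- condition (I)
    (hI : ∀ t : Fin d → ℝ, (∀ i, 0 < t i) → 0 < Ω t)
    -- condition (II)
    (hII : ∃ C > (0:ℝ), ∀ t t' : Fin d → ℝ, (∀ i, 0 ≤ t i) → (∀ i, t i ≤ t' i) →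
      Ω t ≤ C * Ω t')
    -- condition (III)
    (hIII : ∀ γ : Fin d → ℝ, (∀ i, 1 ≤ γ i) → ∃ C' > (0:ℝ),
      ∀ lamv : Fin d → ℝ, (∀ i, 0 ≤ lamv i) → (∀ i, lamv i ≤ γ i) →
      ∀ t : Fin d → ℝ, (∀ i, 0 ≤ t i) → Ω (fun i => lamv i * t i) ≤ C' * Ω t)
    -- `μ > 0` and `ρ < min(r, r-1+1/p)`
    (hμ : 0 < μ) (hρ : ρ < min (r : ℝ) ((r : ℝ) - 1 + p⁻¹.toReal))
    -- condition (a)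
    (ha : ∃ C₁ > (0:ℝ), ∀ t t' : Fin d → ℝ, t ∈ cube d → t' ∈ cube d →
      (∀ i, 0 < t i) → (∀ i, t i ≤ t' i) →
      Ω t * ∏ i, t i ^ (-μ) ≤ C₁ * (Ω t' * ∏ i, t' i ^ (-μ)))
    -- condition (b)
    (hb : ∃ C₂ > (0:ℝ), ∀ t t' : Fin d → ℝ, t ∈ cube d → t' ∈ cube d →
      (∀ i, 0 < t i) → (∀ i, t i ≤ t' i) →
      Ω t * ∏ i, t i ^ (-ρ) ≥ C₂ * (Ω t' * ∏ i, t' i ^ (-ρ))) :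
    ∃ C > (0:ℝ), ∀ (g : (Fin d → ℝ) → ℝ) (gk : (Fin d → ℕ) → (Fin d → ℝ) → ℝ),
      (∀ k, gk k ∈ SigmaRd d r k) → ConvLinf d gk g →
      B4seq d p θ Ω gk ≠ ∞ →
      besovNorm d r p θ Ω g ≤ ENNReal.ofReal C * B4seq d p θ Ω gk := by
  obtain ⟨C₁, hC1, ha⟩ := ha
  obtain ⟨C₂, hC2, hb⟩ := hb
  have h := fun e => semi_le hr hp.ne' hθ.ne' hI hIII hμ hρ hC1 hC2 ha hb e
  choose Ce hCe using h
  refine ⟨((∑ e, Ce e : NNReal) : ℝ) + 1, by positivity, fun g gk hgk hconv _ => ?_⟩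
  unfold besovNorm
  calc _ ≤ ∑ e, (Ce e : ℝ≥0∞) * B4seq d p θ Ω gk :=
        Finset.sum_le_sum fun e _ => hCe e g gk hgk hconv
    _ = ((∑ e, Ce e : NNReal) : ℝ≥0∞) * B4seq d p θ Ω gk := by
        rw [← Finset.sum_mul, ENNReal.coe_finsetSum]
    _ ≤ _ := by
        gcongr
        rw [← ENNReal.ofReal_coe_nnreal]
        exact ENNReal.ofReal_le_ofReal (by linarith)
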